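/- arXiv:2106.14759 — 2 statements merged into one kernel-verified Lean document; each statement's English description precedes it below -/
import Mathlib

section
/- (Clements–Lindström) Let a = (a_1,…,a_r) be a degree sequence and let I ⊆ A = K[x_1,…,x_n] be a homogeneous ideal containing the pure-powers ideal 𝔞 = (x_1^{a_1},…,x_r^{a_r}). Then there exists an a-lpp ideal J ⊆ A with the same Hilbert function as I, i.e. dim_K J_d = dim_K I_d for all d ≥ 0. -/
open MvPolynomial

section Defs

variable {K : Type*} [Field K]

/-- Total degree of an exponent vector. -/
def expDeg {n : ℕ} (m : Fin n →₀ ℕ) : ℕ := ∑ i, m i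

/-- `lexLe m m'` means `m ≤ m'` in the lexicographic order with `x_1 > x_2 > … > x_n`. -/
def lexLe {n : ℕ} (m m' : Fin n →₀ ℕ) : Prop :=
  m = m' ∨ ∃ i : Fin n, (∀ j : Fin n, j < i → m j = m' j) ∧ m i < m' i

/-- A lex-segment in degree `d`: an upward (w.r.t. lex) closed set of degree-`d`
exponent vectors. -/
def IsLexSegment (n d : ℕ) (S : Set (Fin n →₀ ℕ)) : Prop :=
  (∀ m ∈ S, expDeg m = d) ∧
    ∀ m ∈ S, ∀ m' : Fin n →₀ ℕ, expDeg m' = d → lexLe m m' → m' ∈ S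

/-- The pure-powers ideal `(x_1^{a_1}, …, x_r^{a_r})`. -/
noncomputable def purePowers (K : Type*) [Field K] {n r : ℕ} (hrn : r ≤ n)
    (a : Fin r → ℕ) : Ideal (MvPolynomial (Fin n) K) :=
  Ideal.span (Set.range fun i : Fin r => X (Fin.castLE hrn i) ^ a i)

/-- A homogeneous ideal. -/
def IsHomog {n : ℕ} (I : Ideal (MvPolynomial (Fin n) K)) : Prop :=
  ∀ f ∈ I, ∀ d : ℕ, homogeneousComponent d f ∈ I

/-- The degree-`d` component of an ideal, as a `K`-subspace. -/
noncomputable def component {n : ℕ} (I : Ideal (MvPolynomial (Fin n) K)) (d : ℕ) :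
    Submodule K (MvPolynomial (Fin n) K) :=
  Submodule.restrictScalars K I ⊓ homogeneousSubmodule (Fin n) K d

/-- Hilbert function of an ideal: `dim_K I_d`. -/
noncomputable def hilb {n : ℕ} (I : Ideal (MvPolynomial (Fin n) K)) (d : ℕ) : ℕ :=
  Module.finrank K ↥(component I d)

/-- An `a`-lpp (lex-plus-powers) ideal: a homogeneous (monomial) ideal each of whose graded
components is the span of a lex-segment plus the corresponding component of the
pure-powers ideal. -/
def IsLPP {n r : ℕ} (hrn : r ≤ n) (a : Fin r → ℕ)
    (J : Ideal (MvPolynomial (Fin n) K)) : Prop :=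
  IsHomog J ∧
    ∀ d : ℕ, ∃ S : Set (Fin n →₀ ℕ), IsLexSegment n d S ∧
      component J d =
        Submodule.span K ((fun m => (monomial m (1 : K) : MvPolynomial (Fin n) K)) '' S)
          ⊔ component (purePowers K hrn a) d

/-- `I` satisfies `EGH_a(d)`. -/
def EGHd {n r : ℕ} (hrn : r ≤ n) (a : Fin r → ℕ)
    (I : Ideal (MvPolynomial (Fin n) K)) (d : ℕ) : Prop :=
  ∃ J : Ideal (MvPolynomial (Fin n) K), IsLPP hrn a J ∧
    hilb J d = hilb I d ∧ hilb J (d + 1) ≤ hilb I (d + 1)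

/-- `I` satisfies `EGH_a`. -/
def EGH {n r : ℕ} (hrn : r ≤ n) (a : Fin r → ℕ)
    (I : Ideal (MvPolynomial (Fin n) K)) : Prop :=
  ∀ d : ℕ, EGHd hrn a I d

/-- A monomial ideal. -/
def IsMonomialIdeal {n : ℕ} (I : Ideal (MvPolynomial (Fin n) K)) : Prop :=
  ∃ M : Set (Fin n →₀ ℕ),
    I = Ideal.span ((fun m => (monomial m (1 : K) : MvPolynomial (Fin n) K)) '' M)

/-- A strongly stable (monomial) ideal. -/
def IsStronglyStable {n : ℕ} (S : Ideal (MvPolynomial (Fin n) K)) : Prop :=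
  IsMonomialIdeal S ∧
    ∀ (m : Fin n →₀ ℕ) (i j : Fin n), j ≤ i →
      (monomial (m + Finsupp.single i 1) (1 : K) : MvPolynomial (Fin n) K) ∈ S →
      (monomial (m + Finsupp.single j 1) (1 : K) : MvPolynomial (Fin n) K) ∈ S

/-- An `a`-spp (strongly-stable-plus-powers) ideal. -/
def IsSPP {n r : ℕ} (hrn : r ≤ n) (a : Fin r → ℕ)
    (J : Ideal (MvPolynomial (Fin n) K)) : Prop :=
  ∃ S : Ideal (MvPolynomial (Fin n) K), IsStronglyStable S ∧ J = S ⊔ purePowers K hrn a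

/-- A regular sequence: each `f i` is a non-zerodivisor modulo `(f j : j < i)`. -/
def IsRegSeq {n r : ℕ} (f : Fin r → MvPolynomial (Fin n) K) : Prop :=
  ∀ i : Fin r, ∀ g : MvPolynomial (Fin n) K,
    g * f i ∈ Ideal.span { p | ∃ j : Fin r, j < i ∧ p = f j } →
    g ∈ Ideal.span { p | ∃ j : Fin r, j < i ∧ p = f j }

/-- `I` contains a homogeneous regular sequence of degree `a`. -/
def ContainsRegSeq {n r : ℕ} (a : Fin r → ℕ)
    (I : Ideal (MvPolynomial (Fin n) K)) : Prop :=
  ∃ f : Fin r → MvPolynomial (Fin n) K,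
    (∀ i, f i ∈ I) ∧ IsRegSeq f ∧ ∀ i, (f i).IsHomogeneous (a i)

/-- `dim_K (N/P)` for ideals `P ≤ N` (the `K`-dimension of `N/(N ∩ P)`). -/
noncomputable def quotDim (K : Type*) [Field K] {n : ℕ}
    (N P : Ideal (MvPolynomial (Fin n) K)) : ℕ :=
  Module.finrank K
    (↥(Submodule.restrictScalars K N) ⧸
      Submodule.comap (Submodule.restrictScalars K N).subtype (Submodule.restrictScalars K P))

/-- `dim_K (I/F)_d`. -/
noncomputable def relHilb {n : ℕ} (I F : Ideal (MvPolynomial (Fin n) K)) (d : ℕ) : ℕ :=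
  Module.finrank K
    (↥(component I d) ⧸ Submodule.comap (component I d).subtype (Submodule.restrictScalars K F))

/-- `dim_K (A/I)_d`. -/
noncomputable def hilbQ {n : ℕ} (I : Ideal (MvPolynomial (Fin n) K)) (d : ℕ) : ℕ :=
  Module.finrank K
    (↥(homogeneousSubmodule (Fin n) K d) ⧸
      Submodule.comap (homogeneousSubmodule (Fin n) K d).subtype (Submodule.restrictScalars K I))

end Defs

namespace ClementsLindstrom

/-- The exponent vectors of degree `d` in the box `∏ [0, a i)`. -/
def level {n : ℕ} (a : Fin n → ℕ) (d : ℤ) : Finset (Fin n → ℕ) :=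
  (Fintype.piFinset fun i => Finset.range (a i)).filter fun m => ∑ i, (m i : ℤ) = d

open Classical in
/-- The vectors of degree `e` in the box that dominate a member of `S`. -/
noncomputable def shadow {n : ℕ} (a : Fin n → ℕ) (e : ℤ) (S : Finset (Fin n → ℕ)) :
    Finset (Fin n → ℕ) :=
  (level a e).filter fun m => ∃ s ∈ S, s ≤ m

/-- `T` is a lex-initial segment of the degree `d` part of the box. -/
def IsSeg {n : ℕ} (a : Fin n → ℕ) (d : ℤ) (T : Finset (Fin n → ℕ)) : Prop :=
  T ⊆ level a d ∧ ∀ s ∈ T, ∀ m ∈ level a d, toLex s < toLex m → m ∈ T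

theorem mem_level {n : ℕ} {a : Fin n → ℕ} {d : ℤ} {m : Fin n → ℕ} :
    m ∈ level a d ↔ (∀ i, m i < a i) ∧ ∑ i, (m i : ℤ) = d := by
  simp [level]

theorem mem_shadow {n : ℕ} {a : Fin n → ℕ} {e : ℤ} {S : Finset (Fin n → ℕ)} {m : Fin n → ℕ} :
    m ∈ shadow a e S ↔ m ∈ level a e ∧ ∃ s ∈ S, s ≤ m := by
  simp [shadow]

theorem shadow_subset_level {n : ℕ} {a : Fin n → ℕ} {e : ℤ} {S : Finset (Fin n → ℕ)} :
    shadow a e S ⊆ level a e := fun _ hx => (mem_shadow.1 hx).1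

theorem shadow_mono {n : ℕ} {a : Fin n → ℕ} {e : ℤ} {S T : Finset (Fin n → ℕ)} (h : S ⊆ T) :
    shadow a e S ⊆ shadow a e T := by
  intro m hm
  rw [mem_shadow] at hm ⊢
  obtain ⟨h1, s, hs, h2⟩ := hm
  exact ⟨h1, s, h hs, h2⟩

theorem toLex_lt_iff {n : ℕ} {x y : Fin n → ℕ} :
    toLex x < toLex y ↔ ∃ i, (∀ j < i, x j = y j) ∧ x i < y i := Iff.rfl

theorem IsSeg.subset_or_subset {n : ℕ} {a : Fin n → ℕ} {d : ℤ} {S T : Finset (Fin n → ℕ)}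
    (hS : IsSeg a d S) (hT : IsSeg a d T) : S ⊆ T ∨ T ⊆ S := by
  by_contra! h
  obtain ⟨h1, h2⟩ := h
  obtain ⟨x, hx, hx'⟩ := Finset.not_subset.1 h1
  obtain ⟨y, hy, hy'⟩ := Finset.not_subset.1 h2
  rcases lt_trichotomy (toLex x) (toLex y) with h | h | h
  · exact hy' (hS.2 x hx y (hT.1 hy) h)
  · rw [toLex_inj] at h
    exact hx' (h ▸ hy)
  · exact hx' (hT.2 y hy x (hS.1 hx) h)

theorem IsSeg.subset_of_card_le {n : ℕ} {a : Fin n → ℕ} {d : ℤ} {S T : Finset (Fin n → ℕ)}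
    (hS : IsSeg a d S) (hT : IsSeg a d T) (h : S.card ≤ T.card) : S ⊆ T := by
  rcases hS.subset_or_subset hT with h1 | h1
  · exact h1
  · exact (Finset.eq_of_subset_of_card_le h1 h).ge

theorem exists_isSeg_card {n : ℕ} (a : Fin n → ℕ) (d : ℤ) (k : ℕ) (hk : k ≤ (level a d).card) :
    ∃ T, IsSeg a d T ∧ T.card = k := by
  induction k with
  | zero => exact ⟨∅, ⟨by simp, by simp⟩, rfl⟩
  | succ k ih =>
    obtain ⟨T, hT, hTk⟩ := ih (by omega)
    have hne : (level a d \ T).Nonempty := by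
      rw [← Finset.card_pos, Finset.card_sdiff_of_subset hT.1]
      omega
    obtain ⟨p, hp, hmax⟩ := Finset.exists_max_image _ (fun m => toLex m) hne
    rw [Finset.mem_sdiff] at hp
    refine ⟨insert p T, ⟨Finset.insert_subset hp.1 hT.1, ?_⟩, by
      rw [Finset.card_insert_of_notMem hp.2, hTk]⟩
    intro s hs m hm hlt
    by_contra hmT
    rw [Finset.mem_insert, not_or] at hmT
    rcases Finset.mem_insert.1 hs with rfl | hs
    · exact absurd hlt (not_lt.2 (hmax m (Finset.mem_sdiff.2 ⟨hm, hmT.2⟩)))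
    · exact hmT.2 (hT.2 s hs m hm hlt)

theorem exists_eq_add_single {n : ℕ} {s m : Fin n → ℕ} (hle : s ≤ m)
    (hsum : ∑ i, (m i : ℤ) = ∑ i, (s i : ℤ) + 1) :
    ∃ i, m i = s i + 1 ∧ ∀ j, j ≠ i → m j = s j := by
  have hne : ∃ i, s i < m i := by
    by_contra! h
    have : ∑ i, (m i : ℤ) ≤ ∑ i, (s i : ℤ) :=
      Finset.sum_le_sum fun i _ => by exact_mod_cast h i
    omega
  obtain ⟨i, hi⟩ := hne
  rw [← Finset.add_sum_erase _ _ (Finset.mem_univ i),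
    ← Finset.add_sum_erase _ (fun i => (s i : ℤ)) (Finset.mem_univ i)] at hsum
  have h1 : ∀ j ∈ Finset.univ.erase i, (s j : ℤ) ≤ m j := fun j _ => by exact_mod_cast hle j
  have h2 := Finset.sum_le_sum h1
  have h3 : ∑ j ∈ Finset.univ.erase i, (s j : ℤ) = ∑ j ∈ Finset.univ.erase i, (m j : ℤ) := by
    omega
  refine ⟨i, by omega, fun j hj => ?_⟩
  have := (Finset.sum_eq_sum_iff_of_le h1).1 h3 j (by simp [hj])
  omega

/-- Move `t` units from coordinate `j` to coordinate `i`. -/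
def move {n : ℕ} (m : Fin n → ℕ) (i j : Fin n) (t : ℕ) : Fin n → ℕ :=
  Function.update (Function.update m i (m i + t)) j (m j - t)

theorem move_right {n : ℕ} (m : Fin n → ℕ) (i j : Fin n) (t : ℕ) : move m i j t j = m j - t := by
  simp [move]

theorem move_left {n : ℕ} (m : Fin n → ℕ) {i j : Fin n} (t : ℕ) (h : i ≠ j) :
    move m i j t i = m i + t := by
  simp [move, h]

theorem move_of_ne {n : ℕ} (m : Fin n → ℕ) {i j k : Fin n} (t : ℕ) (hi : k ≠ i) (hj : k ≠ j) :
    move m i j t k = m k := by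
  simp [move, hi, hj]

theorem sum_move {n : ℕ} (m : Fin n → ℕ) {i j : Fin n} (t : ℕ) (h : i ≠ j) (ht : t ≤ m j) :
    ∑ k, (move m i j t k : ℤ) = ∑ k, (m k : ℤ) := by
  have hj : j ∈ Finset.univ.erase i := by simp [h.symm]
  rw [← Finset.add_sum_erase _ _ (Finset.mem_univ i),
    ← Finset.add_sum_erase _ (fun k => (m k : ℤ)) (Finset.mem_univ i),
    ← Finset.add_sum_erase _ _ hj, ← Finset.add_sum_erase _ (fun k => (m k : ℤ)) hj,
    move_right, move_left _ _ h]
  have : ∑ k ∈ (Finset.univ.erase i).erase j, (move m i j t k : ℤ)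
      = ∑ k ∈ (Finset.univ.erase i).erase j, (m k : ℤ) := by
    refine Finset.sum_congr rfl fun k hk => ?_
    simp only [Finset.mem_erase, Finset.mem_univ, and_true] at hk
    rw [move_of_ne _ _ hk.2 hk.1]
  omega

theorem move_mem_level {n : ℕ} {a : Fin n → ℕ} {d : ℤ} {m : Fin n → ℕ} (hm : m ∈ level a d)
    {i j : Fin n} {t : ℕ} (h : i ≠ j) (ht : t ≤ m j) (hi : m i + t < a i) :
    move m i j t ∈ level a d := by
  rw [mem_level] at hm ⊢
  refine ⟨fun k => ?_, by rw [sum_move _ _ h ht, hm.2]⟩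
  by_cases hj : k = j
  · subst hj
    have := hm.1 k
    rw [move_right]
    omega
  · by_cases hki : k = i
    · subst hki
      rwa [move_left _ _ h]
    · rw [move_of_ne _ _ hki hj]
      exact hm.1 k

theorem lt_move {n : ℕ} (m : Fin n → ℕ) {i j : Fin n} {t : ℕ} (h : i < j) (ht : 0 < t) :
    toLex m < toLex (move m i j t) := by
  refine toLex_lt_iff.2 ⟨i, fun k hk => ?_, ?_⟩
  · rw [move_of_ne _ _ hk.ne (hk.trans h).ne]
  · rw [move_left _ _ h.ne]
    omega

theorem move_lt {n : ℕ} (m : Fin n → ℕ) {i j : Fin n} {t : ℕ} (h : j < i) (ht : 0 < t)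
    (htj : t ≤ m j) : toLex (move m i j t) < toLex m := by
  refine toLex_lt_iff.2 ⟨j, fun k hk => ?_, ?_⟩
  · rw [move_of_ne _ _ (hk.trans h).ne hk.ne]
  · rw [move_right]
    omega

theorem sub_single_mem {n : ℕ} {a : Fin n → ℕ} {d : ℤ} {m : Fin n → ℕ} (hm : m ∈ level a (d + 1))
    {i : Fin n} (hi : 0 < m i) : Function.update m i (m i - 1) ∈ level a d := by
  rw [mem_level] at hm ⊢
  constructor
  · intro j
    have := hm.1 j
    by_cases h : j = i
    · subst h; simp; omega
    · simpa [h] using this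
  · have := hm.2
    rw [← Finset.add_sum_erase _ _ (Finset.mem_univ i)] at this ⊢
    have h2 : ∑ k ∈ Finset.univ.erase i, ((Function.update m i (m i - 1) k : ℕ) : ℤ)
        = ∑ k ∈ Finset.univ.erase i, (m k : ℤ) := by
      refine Finset.sum_congr rfl fun k hk => ?_
      rw [Function.update_of_ne (Finset.ne_of_mem_erase hk)]
    rw [h2, Function.update_self]
    omega

theorem update_le {n : ℕ} (m : Fin n → ℕ) (i : Fin n) : Function.update m i (m i - 1) ≤ m := by
  intro j
  by_cases h : j = i
  · subst h; simp
  · simp [h]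

theorem IsSeg.shadow {n : ℕ} {a : Fin n → ℕ} {d : ℤ} {T : Finset (Fin n → ℕ)}
    (hT : IsSeg a d T) : IsSeg a (d + 1) (shadow a (d + 1) T) := by
  refine ⟨shadow_subset_level, fun x hx y hy hlt => ?_⟩
  rw [mem_shadow] at hx
  obtain ⟨hx, s, hs, hsx⟩ := hx
  have hsl := hT.1 hs
  suffices ∃ k, 0 < y k ∧ toLex s ≤ toLex (Function.update y k (y k - 1)) by
    obtain ⟨k, hk, hle⟩ := this
    refine mem_shadow.2 ⟨hy, _, ?_, update_le y k⟩
    rcases hle.lt_or_eq with h | h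
    · exact hT.2 s hs _ (sub_single_mem hy hk) h
    · rw [toLex_inj] at h
      rwa [← h]
  obtain ⟨i, hi, hne⟩ := exists_eq_add_single hsx (by
    rw [(mem_level.1 hx).2, (mem_level.1 hsl).2])
  obtain ⟨j, hj, hlt⟩ := toLex_lt_iff.1 hlt
  by_cases hyi : 0 < y i
  · refine ⟨i, hyi, le_of_lt (toLex_lt_iff.2 ⟨j, fun k hk => ?_, ?_⟩)⟩
    · have := hj k hk
      by_cases h : k = i
      · subst h; simp; omega
      · simp only [Function.update_of_ne h]; rw [← this, hne k h]
    · by_cases h : j = i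
      · subst h; simp; omega
      · simp only [Function.update_of_ne h]; rwa [← hne j h]
  have hji : j < i := by
    by_contra! h
    rcases h.lt_or_eq with h | h
    · have := hj i h
      omega
    · subst h
      omega
  by_cases hk : ∃ k, j < k ∧ 0 < y k
  · obtain ⟨k, hk, hk0⟩ := hk
    refine ⟨k, hk0, le_of_lt (toLex_lt_iff.2 ⟨j, fun l hl => ?_, ?_⟩)⟩
    · rw [Function.update_of_ne (hl.trans hk).ne, ← hj l hl, hne l (hl.trans hji).ne]
    · rwa [Function.update_of_ne hk.ne, ← hne j hji.ne]
  · push Not at hk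
    refine ⟨j, by omega, ?_⟩
    by_contra! hlt'
    obtain ⟨k, hk1, hk2⟩ := toLex_lt_iff.1 hlt'
    have hmem := (mem_level.1 (sub_single_mem hy (i := j) (by omega))).2
    have hsum := (mem_level.1 hsl).2
    have : ∑ l, ((Function.update y j (y j - 1) l : ℕ) : ℤ) < ∑ l, (s l : ℤ) := by
      refine Finset.sum_lt_sum (fun l _ => ?_) ⟨k, Finset.mem_univ k, by exact_mod_cast hk2⟩
      rcases lt_or_ge l k with h | h
      · rw [hk1 l h]
      · rcases h.lt_or_eq with h | h
        · have hkj : j ≤ k := by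
            by_contra! hkj
            rw [Function.update_of_ne hkj.ne, ← hj k hkj, hne k (hkj.trans hji).ne] at hk2
            omega
          have := hk l (hkj.trans_lt h)
          rw [Function.update_of_ne (hkj.trans_lt h).ne']
          omega
        · subst h
          exact_mod_cast hk2.le
    omega

theorem toLex_insertNth_lt {n : ℕ} (i : Fin (n + 1)) (c : ℕ) (x y : Fin n → ℕ) :
    toLex (i.insertNth (α := fun _ => ℕ) c x) < toLex (i.insertNth (α := fun _ => ℕ) c y) ↔
      toLex x < toLex y := by
  rw [toLex_lt_iff, toLex_lt_iff]
  constructor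
  · rintro ⟨k, h1, h2⟩
    rcases Fin.eq_self_or_eq_succAbove i k with rfl | ⟨k, rfl⟩
    · simp at h2
    · refine ⟨k, fun j hj => ?_, by simpa using h2⟩
      simpa using h1 (i.succAbove j) (Fin.succAbove_lt_succAbove_iff.2 hj)
  · rintro ⟨k, h1, h2⟩
    refine ⟨i.succAbove k, fun j hj => ?_, by simpa using h2⟩
    rcases Fin.eq_self_or_eq_succAbove i j with rfl | ⟨j, rfl⟩
    · simp
    · simpa using h1 j (Fin.succAbove_lt_succAbove_iff.1 hj)

theorem insertNth_mem_level {n : ℕ} {a : Fin (n + 1) → ℕ} {d : ℤ} {i : Fin (n + 1)} {c : ℕ}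
    {x : Fin n → ℕ} : i.insertNth (α := fun _ => ℕ) c x ∈ level a d ↔
      c < a i ∧ x ∈ level (fun j => a (i.succAbove j)) (d - c) := by
  rw [mem_level, mem_level, Fin.forall_iff_succAbove i, Fin.sum_univ_succAbove _ i]
  simp only [Fin.insertNth_apply_same, Fin.insertNth_apply_succAbove, and_assoc]
  refine and_congr_right fun _ => and_congr_right fun _ => ?_
  omega

theorem insertNth_le_insertNth {n : ℕ} {i : Fin (n + 1)} {c c' : ℕ} {x y : Fin n → ℕ} :
    i.insertNth (α := fun _ => ℕ) c x ≤ i.insertNth (α := fun _ => ℕ) c' y ↔ c ≤ c' ∧ x ≤ y := by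
  rw [Pi.le_def, Fin.forall_iff_succAbove i]
  simp [Pi.le_def]

theorem sum_lt_sum_of_card_eq {α : Type*} [DecidableEq α] {L U : Finset α} (hc : L.card = U.card)
    (w : α → ℕ) (h : ∀ x ∈ L \ U, ∀ y ∈ U \ L, w x < w y) (hne : L ≠ U) :
    ∑ x ∈ L, w x < ∑ x ∈ U, w x := by
  have hc' : (L \ U).card = (U \ L).card := by
    have h1 := Finset.card_sdiff_add_card_inter L U
    have h2 := Finset.card_sdiff_add_card_inter U L
    rw [Finset.inter_comm] at h2
    omega
  rw [← Finset.sum_inter_add_sum_sdiff L U, ← Finset.sum_inter_add_sum_sdiff U L,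
    Finset.inter_comm U L]
  refine add_lt_add_right ?_ _
  let e := Finset.equivOfCardEq hc'
  rw [← Finset.sum_coe_sort, ← Finset.sum_coe_sort (U \ L), ← e.sum_comp]
  refine Finset.sum_lt_sum_of_nonempty ?_ fun x _ => h x x.2 _ (e x).2
  rw [Finset.univ_nonempty_iff, Finset.nonempty_coe_sort, Finset.sdiff_nonempty]
  exact fun hs => hne (Finset.eq_of_subset_of_card_le hs hc.ge)

/-- The members of `Q` with `i`-th coordinate `c`, with that coordinate removed. -/
def slice {n : ℕ} (i : Fin (n + 1)) (c : ℕ) (Q : Finset (Fin (n + 1) → ℕ)) :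
    Finset (Fin n → ℕ) :=
  (Q.filter fun m => m i = c).image i.removeNth

theorem mem_slice {n : ℕ} {i : Fin (n + 1)} {c : ℕ} {Q : Finset (Fin (n + 1) → ℕ)}
    {x : Fin n → ℕ} : x ∈ slice i c Q ↔ i.insertNth (α := fun _ => ℕ) c x ∈ Q := by
  simp only [slice, Finset.mem_image, Finset.mem_filter]
  constructor
  · rintro ⟨m, ⟨hm, rfl⟩, rfl⟩
    rwa [Fin.insertNth_self_removeNth]
  · intro h
    exact ⟨_, ⟨h, by simp⟩, by simp⟩

theorem sum_eq_sum_slice {n : ℕ} (i : Fin (n + 1)) {N : ℕ} {Q : Finset (Fin (n + 1) → ℕ)}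
    (hN : ∀ m ∈ Q, m i < N) (w : (Fin (n + 1) → ℕ) → ℕ) :
    ∑ m ∈ Q, w m = ∑ c ∈ Finset.range N, ∑ x ∈ slice i c Q,
      w (i.insertNth (α := fun _ => ℕ) c x) := by
  rw [← Finset.sum_fiberwise_of_maps_to (t := Finset.range N) (g := fun m => m i)
    fun m hm => Finset.mem_range.2 (hN m hm)]
  refine Finset.sum_congr rfl fun c _ => ?_
  refine Finset.sum_nbij' i.removeNth (fun x => i.insertNth (α := fun _ => ℕ) c x) ?_ ?_ ?_ ?_ ?_
  · intro m hm
    rw [Finset.mem_filter] at hm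
    rw [mem_slice, ← hm.2, Fin.insertNth_self_removeNth]
    exact hm.1
  · intro x hx
    exact Finset.mem_filter.2 ⟨mem_slice.1 hx, by simp⟩
  · intro m hm
    rw [Finset.mem_filter] at hm
    rw [← hm.2, Fin.insertNth_self_removeNth]
  · intro x _
    simp
  · intro m hm
    rw [Finset.mem_filter] at hm
    rw [← hm.2, Fin.insertNth_self_removeNth]

theorem card_eq_sum_slice {n : ℕ} (i : Fin (n + 1)) {N : ℕ} {Q : Finset (Fin (n + 1) → ℕ)}
    (hN : ∀ m ∈ Q, m i < N) : Q.card = ∑ c ∈ Finset.range N, (slice i c Q).card := by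
  rw [Finset.card_eq_sum_ones, sum_eq_sum_slice i hN]
  simp

theorem slice_subset_level {n : ℕ} {a : Fin (n + 1) → ℕ} {d : ℤ} {Q : Finset (Fin (n + 1) → ℕ)}
    (hQ : Q ⊆ level a d) (i : Fin (n + 1)) (c : ℕ) :
    slice i c Q ⊆ level (fun j => a (i.succAbove j)) (d - c) := fun _ hx =>
  (insertNth_mem_level.1 (hQ (mem_slice.1 hx))).2

theorem mem_slice_shadow {n : ℕ} {a : Fin (n + 1) → ℕ} {d : ℤ} {Q : Finset (Fin (n + 1) → ℕ)}
    (hQ : Q ⊆ level a d) (i : Fin (n + 1)) {c : ℕ} (hc : c < a i) (x : Fin n → ℕ) :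
    x ∈ slice i c (shadow a (d + 1) Q) ↔
      x ∈ shadow (fun j => a (i.succAbove j)) (d - c + 1) (slice i c Q) ∨
        ∃ b, b + 1 = c ∧ x ∈ slice i b Q := by
  rw [mem_slice, mem_shadow, mem_shadow, insertNth_mem_level, sub_add_eq_add_sub]
  constructor
  · rintro ⟨⟨-, hx⟩, s, hs, hle⟩
    obtain ⟨y, c', rfl⟩ : ∃ y c', s = i.insertNth (α := fun _ => ℕ) c' y :=
      ⟨i.removeNth s, s i, (Fin.insertNth_self_removeNth _ _).symm⟩
    obtain ⟨hcc, hyx⟩ := insertNth_le_insertNth.1 hle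
    rcases hcc.lt_or_eq with h | h
    · right
      have hy := (mem_level.1 (insertNth_mem_level.1 (hQ hs)).2).2
      have hx' := (mem_level.1 hx).2
      have hle' : ∀ j ∈ Finset.univ, (y j : ℤ) ≤ x j := fun j _ => by exact_mod_cast hyx j
      have hsum := Finset.sum_le_sum hle'
      have heq : y = x := by
        funext j
        have := (Finset.sum_eq_sum_iff_of_le hle').1 (by omega) j (Finset.mem_univ j)
        omega
      subst heq
      exact ⟨c', by omega, mem_slice.2 hs⟩
    · subst h
      exact Or.inl ⟨hx, y, mem_slice.2 hs, hyx⟩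
  · rintro (⟨hx, s, hs, hle⟩ | ⟨b, rfl, hb⟩)
    · exact ⟨⟨hc, hx⟩, _, mem_slice.1 hs, insertNth_le_insertNth.2 ⟨le_rfl, hle⟩⟩
    · refine ⟨⟨hc, ?_⟩, _, mem_slice.1 hb, insertNth_le_insertNth.2 ⟨by omega, le_rfl⟩⟩
      have := slice_subset_level hQ i b hb
      rwa [show d + 1 - ((b + 1 : ℕ) : ℤ) = d - b by push_cast; ring]

/-- Among sets of equal size, lex segments have the smallest shadow. -/
def ShadowMinimal {n : ℕ} (a : Fin n → ℕ) : Prop :=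
  ∀ (d : ℤ) (S T : Finset (Fin n → ℕ)), S ⊆ level a d → IsSeg a d T → T.card ≤ S.card →
    (shadow a (d + 1) T).card ≤ (shadow a (d + 1) S).card

open Classical in
/-- The number of vectors in the level that are lex-larger than `m`. -/
noncomputable def rank {n : ℕ} (a : Fin n → ℕ) (d : ℤ) (m : Fin n → ℕ) : ℕ :=
  ((level a d).filter fun m' => toLex m < toLex m').card

theorem rank_lt {n : ℕ} {a : Fin n → ℕ} {d : ℤ} {m m' : Fin n → ℕ} (hm' : m' ∈ level a d)
    (h : toLex m < toLex m') : rank a d m' < rank a d m := by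
  classical
  refine Finset.card_lt_card (Finset.ssubset_iff_of_subset ?_ |>.2 ⟨m', ?_, ?_⟩)
  · intro x hx
    rw [Finset.mem_filter] at hx ⊢
    exact ⟨hx.1, h.trans hx.2⟩
  · exact Finset.mem_filter.2 ⟨hm', h⟩
  · exact fun h => lt_irrefl _ (Finset.mem_filter.1 h).2

/-- Replacing the slices of `Q` in direction `i` by lex segments does not enlarge the shadow, and
it lowers the total rank unless `Q` is already compressed in direction `i`. -/
theorem exists_compression {n : ℕ} {a : Fin (n + 1) → ℕ} {d : ℤ} {Q : Finset (Fin (n + 1) → ℕ)}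
    (hQ : Q ⊆ level a d) (i : Fin (n + 1)) (ih : ShadowMinimal fun j => a (i.succAbove j))
    {s m : Fin (n + 1) → ℕ} (hs : s ∈ Q) (hm : m ∈ level a d) (hmQ : m ∉ Q) (hi : s i = m i)
    (hlt : toLex s < toLex m) :
    ∃ Q' ⊆ level a d, Q'.card = Q.card ∧
      (shadow a (d + 1) Q').card ≤ (shadow a (d + 1) Q).card ∧
      ∑ x ∈ Q', rank a d x < ∑ x ∈ Q, rank a d x := by
  choose L hL hLc using fun c : ℕ => exists_isSeg_card (fun j => a (i.succAbove j)) (d - c)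
    (slice i c Q).card (Finset.card_le_card (slice_subset_level hQ i c))
  let Q' := (level a d).filter fun m => (i.removeNth m : Fin n → ℕ) ∈ L (m i)
  have hQ' : Q' ⊆ level a d := Finset.filter_subset _ _
  have hslice : ∀ c, c < a i → slice i c Q' = L c := by
    intro c hc
    ext x
    rw [mem_slice, Finset.mem_filter, insertNth_mem_level]
    simp only [Fin.removeNth_insertNth, Fin.insertNth_apply_same]
    exact ⟨fun h => h.2, fun h => ⟨⟨hc, (hL c).1 h⟩, h⟩⟩
  have hlev : ∀ {e : ℤ} {P : Finset (Fin (n + 1) → ℕ)}, P ⊆ level a e → ∀ m ∈ P, m i < a i :=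
    fun hP m hm => (mem_level.1 (hP hm)).1 i
  refine ⟨Q', hQ', ?_, ?_, ?_⟩
  · rw [card_eq_sum_slice i (hlev hQ'), card_eq_sum_slice i (hlev hQ)]
    refine Finset.sum_congr rfl fun c hc => ?_
    rw [hslice c (Finset.mem_range.1 hc), hLc]
  · rw [card_eq_sum_slice i (hlev shadow_subset_level),
      card_eq_sum_slice i (hlev shadow_subset_level)]
    refine Finset.sum_le_sum fun c hc => ?_
    rw [Finset.mem_range] at hc
    have h1 := ih _ _ _ (slice_subset_level hQ i c) (hL c) (hLc c).le
    have h2 : shadow (fun j => a (i.succAbove j)) (d - c + 1) (slice i c Q) ⊆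
        slice i c (shadow a (d + 1) Q) := fun x hx => (mem_slice_shadow hQ i hc x).2 (Or.inl hx)
    have h3 := h1.trans (Finset.card_le_card h2)
    have h4 := (hL c).shadow
    by_cases hsub : slice i c (shadow a (d + 1) Q') ⊆
        shadow (fun j => a (i.succAbove j)) (d - c + 1) (L c)
    · exact (Finset.card_le_card hsub).trans h3
    obtain ⟨x, hx, hx'⟩ := Finset.not_subset.1 hsub
    rw [mem_slice_shadow hQ' i hc, hslice c hc] at hx
    obtain ⟨b, rfl, hb⟩ := hx.resolve_left hx'
    rw [hslice b (by omega)] at hb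
    have hseg := hL b
    have hd : d - ((b + 1 : ℕ) : ℤ) + 1 = d - b := by push_cast; ring
    rw [hd] at h4 hx'
    have hsub' := (h4.subset_or_subset hseg).resolve_right fun h => hx' (h hb)
    have h5 : slice i (b + 1) (shadow a (d + 1) Q') ⊆ L b := by
      intro y hy
      rw [mem_slice_shadow hQ' i hc, hslice _ hc, hd] at hy
      rcases hy with hy | ⟨b', hb', hy⟩
      · exact hsub' hy
      · obtain rfl : b' = b := by omega
        rwa [hslice b' (by omega)] at hy
    refine (Finset.card_le_card h5).trans ?_
    rw [hLc]
    exact Finset.card_le_card fun y hy => (mem_slice_shadow hQ i hc y).2 (Or.inr ⟨b, rfl, hy⟩)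
  · rw [sum_eq_sum_slice i (hlev hQ'), sum_eq_sum_slice i (hlev hQ)]
    have key : ∀ c, c < a i → L c ≠ slice i c Q →
        ∑ x ∈ L c, rank a d (i.insertNth (α := fun _ => ℕ) c x) <
          ∑ x ∈ slice i c Q, rank a d (i.insertNth (α := fun _ => ℕ) c x) := by
      intro c hc hne
      refine sum_lt_sum_of_card_eq (hLc c) _ (fun x hx y hy => ?_) hne
      rw [Finset.mem_sdiff] at hx hy
      refine rank_lt (insertNth_mem_level.2 ⟨hc, (hL c).1 hx.1⟩) ?_
      refine (toLex_insertNth_lt i c y x).2 ?_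
      rcases lt_trichotomy (toLex y) (toLex x) with h | h | h
      · exact h
      · rw [toLex_inj] at h
        exact absurd (h ▸ hx.1) hy.2
      · exact absurd ((hL c).2 x hx.1 y (slice_subset_level hQ i c hy.1) h) hy.2
    refine Finset.sum_lt_sum (fun c hc => ?_)
      ⟨m i, Finset.mem_range.2 ((mem_level.1 hm).1 i), ?_⟩
    · rw [Finset.mem_range] at hc
      rw [hslice c hc]
      by_cases h : L c = slice i c Q
      · rw [h]
      · exact (key c hc h).le
    · rw [hslice _ ((mem_level.1 hm).1 i)]
      refine key _ ((mem_level.1 hm).1 i) fun h => hmQ ?_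
      have hm1 : i.insertNth (α := fun _ => ℕ) (m i) (i.removeNth m) = m :=
        Fin.insertNth_self_removeNth _ _
      have hs1 : i.insertNth (α := fun _ => ℕ) (m i) (i.removeNth s) = s := by
        rw [← hi, Fin.insertNth_self_removeNth]
      rw [← hm1, ← mem_slice, ← h]
      refine (hL _).2 (i.removeNth s) ?_ _ ?_ ?_
      · rw [h, mem_slice, hs1]
        exact hs
      · rw [← hm1, insertNth_mem_level] at hm
        simpa using hm.2
      · rwa [← toLex_insertNth_lt i (m i), hs1, hm1]

theorem eq_of_le_add_last {n : ℕ} {s q : Fin (n + 1) → ℕ}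
    (hsum : ∑ i, (s i : ℤ) = ∑ i, (q i : ℤ)) (h : ∀ i, i ≠ Fin.last n → s i ≤ q i)
    (hle : toLex q ≤ toLex s) : s = q := by
  rcases hle.lt_or_eq with hlt | heq
  · obtain ⟨k, hk, hlt⟩ := toLex_lt_iff.1 hlt
    have hkl : k = Fin.last n := by
      by_contra hne
      have := h k hne
      omega
    subst hkl
    exfalso
    have : ∑ i, (q i : ℤ) < ∑ i, (s i : ℤ) := by
      refine Finset.sum_lt_sum (fun i _ => ?_) ⟨_, Finset.mem_univ _, by exact_mod_cast hlt⟩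
      rcases (Fin.le_last i).lt_or_eq with hi | rfl
      · rw [hk i hi]
      · exact_mod_cast hlt.le
    omega
  · exact (toLex_inj.1 heq).symm

theorem last_lt_of_compressed {n : ℕ} {a : Fin (n + 3) → ℕ} {d : ℤ}
    {Q : Finset (Fin (n + 3) → ℕ)}
    (hcomp : ∀ i, ∀ s ∈ Q, ∀ m ∈ level a d, s i = m i → toLex s < toLex m → m ∈ Q)
    {p q : Fin (n + 3) → ℕ} (hp : p ∈ level a d) (hpQ : p ∉ Q) (hq : q ∈ level a d) (hqQ : q ∈ Q)
    (hlt : toLex q < toLex p) : q (Fin.last _) < p (Fin.last _) := by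
  have hne : ∀ i, q i ≠ p i := fun i h => hpQ (hcomp i q hqQ p hp h hlt)
  have hno : ∀ m ∈ level a d, toLex q < toLex m → toLex m < toLex p →
      ∀ i j, q i = m i → m j = p j → False := fun m hm h1 h2 i j hi hj =>
    hpQ (hcomp j m (hcomp i q hqQ m hm hi h1) p hp hj h2)
  have h0 : q 0 < p 0 := by
    obtain ⟨k, hk, hlt⟩ := toLex_lt_iff.1 hlt
    rcases (Fin.zero_le k).lt_or_eq with h | h
    · exact absurd (hk 0 h) (hne 0)
    · rwa [h]
  have hpa := (mem_level.1 hp).1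
  have hqa := (mem_level.1 hq).1
  have hlt_of : ∀ x y : Fin (n + 3) → ℕ, x 0 < y 0 → toLex x < toLex y := fun x y h =>
    toLex_lt_iff.2 ⟨0, fun j hj => absurd hj (Fin.not_lt_zero j), h⟩
  by_contra! hle
  have hpq : p (Fin.last _) < q (Fin.last _) := lt_of_le_of_ne hle (hne _).symm
  set l : Fin (n + 3) := Fin.last _ with hl
  have hl0 : (0 : Fin (n + 3)) < l := Fin.last_pos
  have hmid : ∀ j, j ≠ 0 → j ≠ l → p j < q j := by
    intro j hj0 hjl
    by_contra! hj
    have hj := lt_of_le_of_ne hj (hne j)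
    by_cases hc : p j - q j ≤ q l
    · refine hno (move q j l (p j - q j))
        (move_mem_level hq hjl hc (by have := hpa j; omega))
        (lt_move q (lt_of_le_of_ne (Fin.le_last j) hjl) (by omega)) (hlt_of _ _ ?_) 0 j ?_ ?_
      · rwa [move_of_ne _ _ hj0.symm hl0.ne]
      · rw [move_of_ne _ _ hj0.symm hl0.ne]
      · rw [move_left _ _ hjl]
        omega
    · refine hno (move p l j (q l - p l))
        (move_mem_level hp hjl.symm (by omega) (by have := hqa l; omega)) (hlt_of _ _ ?_)
        (move_lt p (lt_of_le_of_ne (Fin.le_last j) hjl) (by omega) (by omega)) l 0 ?_ ?_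
      · rwa [move_of_ne _ _ hl0.ne hj0.symm]
      · rw [move_left _ _ hjl.symm]
        omega
      · rw [move_of_ne _ _ hl0.ne hj0.symm]
  have h1l : (1 : Fin (n + 3)) ≠ l := by
    rw [hl, Ne, Fin.ext_iff]
    simp
  have h10 : (1 : Fin (n + 3)) ≠ 0 := by simp
  have hsum : q 0 + (q l - p l) < p 0 := by
    have h1 := (mem_level.1 hp).2.trans (mem_level.1 hq).2.symm
    have e : ∀ x : Fin (n + 3) → ℕ, ∑ i, (x i : ℤ) =
        x 0 + (x l + ∑ i ∈ (Finset.univ.erase 0).erase l, (x i : ℤ)) := fun x => by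
      rw [Finset.add_sum_erase _ (fun i => (x i : ℤ)) (by simp [hl0.ne']),
        Finset.add_sum_erase _ (fun i => (x i : ℤ)) (Finset.mem_univ 0)]
    rw [e p, e q] at h1
    have : ∑ i ∈ (Finset.univ.erase 0).erase l, (p i : ℤ) <
        ∑ i ∈ (Finset.univ.erase 0).erase l, (q i : ℤ) := by
      refine Finset.sum_lt_sum_of_nonempty ⟨1, by simp [h1l]⟩ fun j hj => ?_
      simp only [Finset.mem_erase, Finset.mem_univ, and_true] at hj
      exact_mod_cast hmid j hj.2 hj.1
    omega
  refine hno (move p l 0 (q l - p l))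
    (move_mem_level hp hl0.ne' (by omega) (by have := hqa l; omega)) (hlt_of _ _ ?_)
    (move_lt p hl0 (by omega) (by omega)) l 1 ?_ ?_
  · rw [move_right]
    omega
  · rw [move_left _ _ hl0.ne']
    omega
  · rw [move_of_ne _ _ h1l h10]

theorem exists_exchange {n : ℕ} {a : Fin (n + 3) → ℕ} {d : ℤ}
    {Q : Finset (Fin (n + 3) → ℕ)} (hQ : Q ⊆ level a d)
    (hcomp : ∀ i, ∀ s ∈ Q, ∀ m ∈ level a d, s i = m i → toLex s < toLex m → m ∈ Q)
    (hseg : ¬ IsSeg a d Q) :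
    ∃ Q' ⊆ level a d, Q'.card = Q.card ∧
      (shadow a (d + 1) Q').card ≤ (shadow a (d + 1) Q).card ∧
      ∑ x ∈ Q', rank a d x < ∑ x ∈ Q, rank a d x := by
  obtain ⟨s, hs, m, hm, hsm, hmQ⟩ : ∃ s ∈ Q, ∃ m ∈ level a d, toLex s < toLex m ∧ m ∉ Q := by
    by_contra! h
    exact hseg ⟨hQ, h⟩
  obtain ⟨p, hp, hpmax⟩ := Finset.exists_max_image (level a d \ Q) (fun m => toLex m)
    ⟨m, Finset.mem_sdiff.2 ⟨hm, hmQ⟩⟩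
  obtain ⟨q, hqQ, hqmin⟩ := Finset.exists_min_image Q (fun m => toLex m) ⟨s, hs⟩
  have hlt : toLex q < toLex p := (hqmin s hs).trans_lt
    (hsm.trans_le (hpmax m (Finset.mem_sdiff.2 ⟨hm, hmQ⟩)))
  rw [Finset.mem_sdiff] at hp
  obtain ⟨hp, hpQ⟩ := hp
  have hq := hQ hqQ
  have hlast := last_lt_of_compressed hcomp hp hpQ hq hqQ hlt
  obtain ⟨l, hl⟩ : ∃ l, l = Fin.last (n + 2) := ⟨_, rfl⟩
  rw [← hl] at hlast
  have hlel : ∀ i, i ≤ l := fun i => hl ▸ Fin.le_last i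
  obtain ⟨q', hq'⟩ : ∃ q', q' = Function.update q l (q l + 1) := ⟨_, rfl⟩
  obtain ⟨p', hp'⟩ : ∃ p', p' = Function.update p l (p l + 1) := ⟨_, rfl⟩
  have hqq' : ∀ i, q i ≤ q' i := fun i => by
    by_cases h : i = l
    · subst h; simp [hq']
    · simp [hq', h]
  have huniq : ∀ z ∈ Q, z ≤ q' → z = q := by
    intro z hz hzq
    refine eq_of_le_add_last ((mem_level.1 (hQ hz)).2.trans (mem_level.1 hq).2.symm)
      (fun i hi => ?_) (hqmin z hz)
    rw [← hl] at hi
    simpa [hq', Function.update_of_ne hi] using hzq i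
  have hq'mem : q' ∈ shadow a (d + 1) Q := by
    refine mem_shadow.2 ⟨mem_level.2 ⟨fun i => ?_, ?_⟩, q, hqQ, hqq'⟩
    · by_cases h : i = l
      · subst h
        have := (mem_level.1 hp).1 i
        simp only [hq', Function.update_self]
        omega
      · simpa [hq', h] using (mem_level.1 hq).1 i
    · rw [← (mem_level.1 hq).2, ← Finset.add_sum_erase _ _ (Finset.mem_univ l),
        ← Finset.add_sum_erase _ (fun i => (q i : ℤ)) (Finset.mem_univ l)]
      have : ∑ i ∈ Finset.univ.erase l, (q' i : ℤ) = ∑ i ∈ Finset.univ.erase l, (q i : ℤ) :=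
        Finset.sum_congr rfl fun i hi => by
          rw [hq', Function.update_of_ne (Finset.ne_of_mem_erase hi)]
      rw [this, hq', Function.update_self]
      push_cast
      ring
  have hpe : p ∉ Q.erase q := fun h => hpQ (Finset.mem_of_mem_erase h)
  refine ⟨insert p (Q.erase q), Finset.insert_subset hp ((Finset.erase_subset _ _).trans hQ),
    ?_, ?_, ?_⟩
  · rw [Finset.card_insert_of_notMem hpe, Finset.card_erase_add_one hqQ]
  · have hsub : shadow a (d + 1) (insert p (Q.erase q)) ⊆
        insert p' ((shadow a (d + 1) Q).erase q') := by
      intro x hx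
      rw [mem_shadow] at hx
      obtain ⟨hx, z, hz, hzx⟩ := hx
      rw [Finset.mem_insert]
      by_cases hxp : x = p'
      · exact Or.inl hxp
      right
      suffices h : ∃ z ∈ Q, z ≠ q ∧ z ≤ x by
        obtain ⟨z, hz, hzq, hzx⟩ := h
        refine Finset.mem_erase.2 ⟨?_, mem_shadow.2 ⟨hx, z, hz, hzx⟩⟩
        rintro rfl
        exact hzq (huniq z hz hzx)
      rcases Finset.mem_insert.1 hz with rfl | hz
      · have hsum : ∑ i, (x i : ℤ) = ∑ i, (z i : ℤ) + 1 :=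
          (mem_level.1 hx).2.trans (congrArg (· + 1) (mem_level.1 hp).2.symm)
        obtain ⟨i, hi, hne⟩ := exists_eq_add_single hzx hsum
        have hil : i ≠ l := by
          rintro rfl
          refine hxp (funext fun j => ?_)
          by_cases h : j = i
          · subst h; simp [hp', hi]
          · simp [hp', h, hne j h]
        have hmv : move z i l 1 ∈ level a d := move_mem_level hp hil (by omega)
          (by rw [← hi]; exact (mem_level.1 hx).1 i)
        have hgt : toLex z < toLex (move z i l 1) :=
          lt_move z (lt_of_le_of_ne (hlel i) hil) one_pos
        refine ⟨move z i l 1, ?_, ?_, fun j => ?_⟩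
        · by_contra h
          exact absurd hgt (not_lt.2 (hpmax _ (Finset.mem_sdiff.2 ⟨hmv, h⟩)))
        · intro h
          rw [h] at hgt
          exact lt_asymm hgt hlt
        · by_cases hj : j = l
          · subst hj
            rw [move_right, hne _ hil.symm]
            exact Nat.sub_le _ _
          · by_cases hji : j = i
            · subst hji
              rw [move_left _ _ hil, hi]
            · rw [move_of_ne _ _ hji hj, hne j hji]
      · rw [Finset.mem_erase] at hz
        exact ⟨z, hz.2, hz.1, hzx⟩
    refine (Finset.card_le_card hsub).trans ((Finset.card_insert_le _ _).trans ?_)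
    rw [Finset.card_erase_add_one hq'mem]
  · rw [Finset.sum_insert hpe, ← Finset.add_sum_erase _ _ hqQ]
    exact add_lt_add_left (rank_lt hp hlt) _

theorem shadowMinimal_of_succAbove {n : ℕ} {a : Fin (n + 3) → ℕ}
    (ih : ∀ i : Fin (n + 3), ShadowMinimal fun j => a (i.succAbove j)) : ShadowMinimal a := by
  intro d S T hS hT hcard
  let P : Finset (Fin (n + 3) → ℕ) → Prop := fun Q =>
    Q ⊆ level a d ∧ Q.card = S.card ∧ (shadow a (d + 1) Q).card ≤ (shadow a (d + 1) S).card
  suffices h : ∃ Q, P Q ∧ IsSeg a d Q by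
    obtain ⟨Q, ⟨-, hQc, hQs⟩, hseg⟩ := h
    exact (Finset.card_le_card (shadow_mono
      (hT.subset_of_card_le hseg (hcard.trans hQc.ge)))).trans hQs
  have hne : {Q | P Q}.Nonempty := ⟨S, hS, rfl, le_rfl⟩
  let Φ : Finset (Fin (n + 3) → ℕ) → ℕ := fun Q => ∑ x ∈ Q, rank a d x
  obtain ⟨Q, hQ, hmin⟩ := WellFounded.has_min (measure Φ).wf {Q | P Q} hne
  have hmin' : ¬ ∃ Q' ⊆ level a d, Q'.card = Q.card ∧
      (shadow a (d + 1) Q').card ≤ (shadow a (d + 1) Q).card ∧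
      ∑ x ∈ Q', rank a d x < ∑ x ∈ Q, rank a d x := by
    rintro ⟨Q', h1, h2, h3, h4⟩
    exact hmin Q' ⟨h1, h2.trans hQ.2.1, h3.trans hQ.2.2⟩ h4
  refine ⟨Q, hQ, ?_⟩
  by_contra hseg
  refine hmin' (exists_exchange hQ.1 (fun i s hs m hm hi hlt => ?_) hseg)
  by_contra hmQ
  exact hmin' (exists_compression hQ.1 i (ih i) hs hm hmQ hi hlt)

theorem IsSeg.subset_of_subsingleton {n : ℕ} [Subsingleton (Fin n)] {a : Fin n → ℕ} {d : ℤ}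
    {S T : Finset (Fin n → ℕ)} (hS : S ⊆ level a d) (hT : IsSeg a d T)
    (hcard : T.card ≤ S.card) : T ⊆ S := by
  have hsub : ∀ x ∈ level a d, ∀ y ∈ level a d, x = y := by
    intro x hx y hy
    funext i
    have h := (mem_level.1 hx).2.trans (mem_level.1 hy).2.symm
    rw [Fintype.sum_subsingleton _ i, Fintype.sum_subsingleton _ i] at h
    exact_mod_cast h
  intro x hx
  obtain ⟨y, hy⟩ := Finset.card_pos.1 ((Finset.card_pos.2 ⟨x, hx⟩).trans_le hcard)
  rwa [hsub x (hT.1 hx) y (hS hy)]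

theorem shadowMinimal_of_subsingleton {n : ℕ} [Subsingleton (Fin n)] (a : Fin n → ℕ) :
    ShadowMinimal a := fun _ _ _ hS hT hcard =>
  Finset.card_le_card (shadow_mono (hT.subset_of_subsingleton hS hcard))

theorem mem_level_two {a : Fin 2 → ℕ} {d : ℤ} {m : Fin 2 → ℕ} :
    m ∈ level a d ↔ m 0 < a 0 ∧ m 1 < a 1 ∧ (m 0 : ℤ) + m 1 = d := by
  rw [mem_level, Fin.forall_fin_two, Fin.sum_univ_two, and_assoc]

theorem injOn_level_two {a : Fin 2 → ℕ} {d : ℤ} :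
    Set.InjOn (fun m : Fin 2 → ℕ => m 0) (level a d) := by
  intro x hx y hy hxy
  have h1 := (mem_level_two.1 hx).2.2
  have h2 := (mem_level_two.1 hy).2.2
  simp only at hxy
  funext i
  fin_cases i
  · exact hxy
  · simp only [Fin.mk_one]
    omega

theorem card_image_of_subset_level_two {a : Fin 2 → ℕ} {d : ℤ} {S : Finset (Fin 2 → ℕ)}
    (hS : S ⊆ level a d) : (S.image fun m => m 0).card = S.card :=
  Finset.card_image_of_injOn (injOn_level_two.mono (Finset.coe_subset.2 hS))

theorem image_shadow_two_subset {a : Fin 2 → ℕ} {d : ℤ} {T : Finset (Fin 2 → ℕ)}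
    (hT : IsSeg a d T) {c : ℕ} (hc : c ∈ (shadow a (d + 1) T).image fun m => m 0) :
    c ∈ T.image (fun m => m 0) ∨ ((c : ℤ) = d + 1 ∧ c < a 0) := by
  obtain ⟨m, hm, rfl⟩ := Finset.mem_image.1 hc
  rw [mem_shadow] at hm
  obtain ⟨hm, s, hs, hle⟩ := hm
  have hsl := mem_level_two.1 (hT.1 hs)
  have hml := mem_level_two.1 hm
  have h0 := hle 0
  have h1 := hle 1
  rcases h0.lt_or_eq with h | h
  · by_cases hm1 : m 1 = 0
    · right
      omega
    · left
      refine Finset.mem_image.2 ⟨![m 0, m 1 - 1], hT.2 s hs _ ?_ ?_, rfl⟩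
      · rw [mem_level_two]
        simp
        omega
      · exact toLex_lt_iff.2 ⟨0, fun j hj => absurd hj (Fin.not_lt_zero j), h⟩
  · exact Or.inl (Finset.mem_image.2 ⟨s, hs, h⟩)

theorem mem_image_shadow_two {a : Fin 2 → ℕ} {d : ℤ} {S : Finset (Fin 2 → ℕ)}
    (hS : S ⊆ level a d) {s : Fin 2 → ℕ} (hs : s ∈ S) {t : ℕ} (ht : t ≤ 1)
    (h0 : s 0 + t < a 0) (h1 : s 1 + (1 - t) < a 1) :
    s 0 + t ∈ (shadow a (d + 1) S).image fun m => m 0 := by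
  have hsl := mem_level_two.1 (hS hs)
  refine Finset.mem_image.2 ⟨![s 0 + t, s 1 + (1 - t)], mem_shadow.2 ⟨?_, s, hs, ?_⟩, rfl⟩
  · rw [mem_level_two]
    simp
    omega
  · intro i
    fin_cases i <;> simp

theorem shadowMinimal_two {a : Fin 2 → ℕ} (ha : a 0 ≤ a 1) : ShadowMinimal a := by
  intro d S T hS hT hcard
  rw [← card_image_of_subset_level_two (shadow_subset_level (S := S)),
    ← card_image_of_subset_level_two (shadow_subset_level (S := T))]
  rw [← card_image_of_subset_level_two hS, ← card_image_of_subset_level_two hT.1] at hcard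
  by_cases hd : d + 1 < a 0
  · rcases T.eq_empty_or_nonempty with rfl | hne
    · simp [shadow]
    have hSne : S.Nonempty := by
      rw [← Finset.image_nonempty (f := fun m : Fin 2 → ℕ => m 0), ← Finset.card_pos]
      exact (Finset.card_pos.2 (hne.image _)).trans_le hcard
    obtain ⟨t, ht, hmax⟩ := Finset.exists_max_image S (fun m => m 0) hSne
    have h1 : (shadow a (d + 1) T).image (fun m => m 0) ⊆
        insert (d + 1).toNat (T.image fun m => m 0) := by
      intro c hc
      rw [Finset.mem_insert]
      rcases image_shadow_two_subset hT hc with h | h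
      · exact Or.inr h
      · left
        omega
    have h2 : insert (t 0 + 1) (S.image fun m => m 0) ⊆
        (shadow a (d + 1) S).image fun m => m 0 := by
      intro c hc
      rcases Finset.mem_insert.1 hc with rfl | hc
      · have := mem_level_two.1 (hS ht)
        exact mem_image_shadow_two hS ht le_rfl (by omega) (by omega)
      · obtain ⟨s, hs, rfl⟩ := Finset.mem_image.1 hc
        have := mem_level_two.1 (hS hs)
        exact mem_image_shadow_two hS hs (t := 0) (by omega) (by omega) (by omega)
    have h3 : t 0 + 1 ∉ S.image fun m => m 0 := by
      intro h
      obtain ⟨s, hs, h⟩ := Finset.mem_image.1 h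
      have := hmax s hs
      omega
    have h4 := Finset.card_le_card h2
    rw [Finset.card_insert_of_notMem h3] at h4
    have h5 := (Finset.card_le_card h1).trans (Finset.card_insert_le _ _)
    omega
  · by_cases hSl : S = level a d
    · exact Finset.card_le_card (Finset.image_subset_image
        (shadow_mono (hSl ▸ hT.1)))
    obtain ⟨p, hp, hpS⟩ := Finset.exists_of_ssubset (hS.ssubset_of_ne hSl)
    have hpl := mem_level_two.1 hp
    have h1 : (shadow a (d + 1) T).image (fun m => m 0) ⊆ T.image fun m => m 0 := by
      intro c hc
      refine (image_shadow_two_subset hT hc).resolve_right ?_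
      omega
    refine (Finset.card_le_card h1).trans (hcard.trans ?_)
    refine Finset.card_le_card_of_injOn (fun c => if p 0 < c then c else c + 1) ?_ ?_
    · intro c hc
      obtain ⟨s, hs, rfl⟩ := Finset.mem_image.1 (Finset.mem_coe.1 hc)
      have hsl := mem_level_two.1 (hS hs)
      have hne : s 0 ≠ p 0 := fun h => hpS (injOn_level_two (hS hs) hp h ▸ hs)
      rw [Finset.mem_coe]
      simp only
      split_ifs with h
      · exact mem_image_shadow_two hS hs (t := 0) (by omega) (by omega) (by omega)
      · exact mem_image_shadow_two hS hs le_rfl (by omega) (by omega)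
    · intro c hc c' hc' h
      have hne : ∀ c ∈ S.image (fun m => m 0), c ≠ p 0 := by
        intro c hc h
        obtain ⟨s, hs, rfl⟩ := Finset.mem_image.1 hc
        exact hpS (injOn_level_two (hS hs) hp h ▸ hs)
      have h1 := hne c hc
      have h2 := hne c' hc'
      simp only at h
      split_ifs at h <;> omega

/-- The combinatorial Clements–Lindström theorem. -/
theorem shadowMinimal_of_monotone : ∀ {n : ℕ} {a : Fin n → ℕ}, Monotone a → ShadowMinimal a
  | 0, a, _ => shadowMinimal_of_subsingleton a
  | 1, a, _ => shadowMinimal_of_subsingleton a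
  | 2, _, h => shadowMinimal_two (h (Fin.zero_le 1))
  | _ + 3, _, h => shadowMinimal_of_succAbove fun i =>
      shadowMinimal_of_monotone (h.comp (Fin.strictMono_succAbove i).monotone)

/-- The exponents of the leading monomials of the nonzero members of `V`. -/
def leadSet {σ K : Type*} [Field K] (o : MonomialOrder σ) (V : Submodule K (MvPolynomial σ K)) :
    Set (σ →₀ ℕ) :=
  {u | ∃ f ∈ V, f ≠ 0 ∧ o.degree f = u}

theorem finrank_eq_ncard_leadSet {σ K : Type*} [Field K] (o : MonomialOrder σ)
    (V : Submodule K (MvPolynomial σ K)) (hfin : (leadSet o V).Finite) :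
    Module.finrank K V = (leadSet o V).ncard := by
  classical
  have : Fintype (leadSet o V) := hfin.fintype
  let φ : V →ₗ[K] (leadSet o V → K) :=
    LinearMap.pi fun u => (lcoeff K (u : σ →₀ ℕ)) ∘ₗ V.subtype
  have hφ : Function.Injective φ := by
    rw [injective_iff_map_eq_zero]
    intro f hf
    by_contra hne
    have hne' : (f : MvPolynomial σ K) ≠ 0 := fun h => hne (Subtype.ext h)
    have h := congrFun hf ⟨o.degree (f : MvPolynomial σ K), f, f.2, hne', rfl⟩
    exact o.coeff_degree_ne_zero_iff.2 hne' h
  have : Module.Finite K V := Module.Finite.of_injective φ hφ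
  rw [← Nat.card_coe_set_eq, Nat.card_eq_fintype_card]
  refine le_antisymm ?_ ?_
  · have := LinearMap.finrank_le_finrank_of_injective hφ
    rwa [Module.finrank_fintype_fun_eq_card] at this
  · choose f hfV hf0 hfd using fun u : leadSet o V => u.2
    have hli : LinearIndependent K fun u => (⟨f u, hfV u⟩ : V) := by
      rw [Fintype.linearIndependent_iff]
      intro g hg
      by_contra! hne
      obtain ⟨u, hu, hmax⟩ := Finset.exists_max_image
        (Finset.univ.filter fun u => g u ≠ 0) (fun u => o.toSyn (u : σ →₀ ℕ))
        (hne.imp fun u hu => by simpa using hu)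
      have hg' : ∑ v, g v • f v = 0 := by
        simpa using congrArg Subtype.val hg
      have hcoeff := congrArg (coeff (u : σ →₀ ℕ)) hg'
      rw [coeff_sum, Finset.sum_eq_single u, coeff_smul, coeff_zero, smul_eq_mul] at hcoeff
      · rcases mul_eq_zero.1 hcoeff with h | h
        · exact (Finset.mem_filter.1 hu).2 h
        · rw [← hfd u] at h
          exact o.coeff_degree_ne_zero_iff.2 (hf0 u) h
      · intro v _ hvu
        rw [coeff_smul, smul_eq_mul, mul_eq_zero]
        by_cases hv : g v = 0
        · exact Or.inl hv
        right
        refine o.coeff_eq_zero_of_lt ?_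
        rw [hfd v]
        refine lt_of_le_of_ne (hmax v (by simpa using hv)) fun h => hvu ?_
        exact Subtype.ext (o.toSyn.injective h)
      · simp
    exact hli.fintype_card_le_finrank

theorem mem_homogeneousSubmodule_iff {n d : ℕ} {K : Type*} [Field K]
    {f : MvPolynomial (Fin n) K} :
    f ∈ homogeneousSubmodule (Fin n) K d ↔ ∀ u ∈ f.support, expDeg u = d := by
  rw [mem_homogeneousSubmodule, IsHomogeneous, IsWeightedHomogeneous]
  refine forall_congr' fun u => ?_
  rw [mem_support_iff, Finsupp.weight_apply, Finsupp.sum_fintype _ _ (by simp)]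
  simp [expDeg]

theorem monomial_mem_component {n : ℕ} {K : Type*} [Field K] {I : Ideal (MvPolynomial (Fin n) K)}
    {u : Fin n →₀ ℕ} {d : ℕ} {c : K} (h : monomial u c ∈ I) (hd : expDeg u = d) :
    monomial u c ∈ component I d := by
  refine ⟨h, mem_homogeneousSubmodule_iff.2 fun v hv => ?_⟩
  rw [Finset.mem_singleton.1 (support_monomial_subset hv), hd]

theorem expDeg_add {n : ℕ} (u v : Fin n →₀ ℕ) : expDeg (u + v) = expDeg u + expDeg v := by
  simp [expDeg, Finset.sum_add_distrib]

theorem expDeg_single {n : ℕ} (i : Fin n) (k : ℕ) : expDeg (Finsupp.single i k) = k := by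
  simp [expDeg, Finsupp.single_apply]

theorem finite_expDeg_eq (n d : ℕ) : {u : Fin n →₀ ℕ | expDeg u = d}.Finite := by
  refine Set.Finite.subset ((level (n := n) (fun _ => d + 1) d).finite_toSet.preimage
    DFunLike.coe_injective.injOn) fun u hu => ?_
  rw [Set.mem_preimage, Finset.mem_coe, mem_level]
  have hu : ∑ i, u i = d := hu
  refine ⟨fun i => ?_, by exact_mod_cast hu⟩
  have := Finset.single_le_sum (fun j _ => Nat.zero_le (u j)) (Finset.mem_univ i)
  omega

theorem leadSet_component_subset {n : ℕ} {K : Type*} [Field K] (o : MonomialOrder (Fin n))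
    (I : Ideal (MvPolynomial (Fin n) K)) (d : ℕ) :
    leadSet o (component I d) ⊆ {u | expDeg u = d} := by
  rintro _ ⟨f, hf, hf0, rfl⟩
  exact mem_homogeneousSubmodule_iff.1 hf.2 _ (o.degree_mem_support hf0)

theorem hilb_eq_ncard_leadSet {n : ℕ} {K : Type*} [Field K] (o : MonomialOrder (Fin n))
    (I : Ideal (MvPolynomial (Fin n) K)) (d : ℕ) :
    hilb I d = (leadSet o (component I d)).ncard :=
  finrank_eq_ncard_leadSet o _ ((finite_expDeg_eq n d).subset (leadSet_component_subset o I d))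

theorem mem_leadSet_of_monomial_mem {n : ℕ} {K : Type*} [Field K] (o : MonomialOrder (Fin n))
    {I : Ideal (MvPolynomial (Fin n) K)} {u : Fin n →₀ ℕ} (h : monomial u (1 : K) ∈ I) :
    u ∈ leadSet o (component I (expDeg u)) := by
  classical
  exact ⟨_, monomial_mem_component h rfl, by simp, by rw [o.degree_monomial]; simp⟩

theorem leadSet_mul {n : ℕ} {K : Type*} [Field K] (o : MonomialOrder (Fin n))
    {I : Ideal (MvPolynomial (Fin n) K)} {u : Fin n →₀ ℕ} {d : ℕ}
    (h : u ∈ leadSet o (component I d)) (v : Fin n →₀ ℕ) :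
    v + u ∈ leadSet o (component I (expDeg v + d)) := by
  classical
  obtain ⟨f, hf, hf0, rfl⟩ := h
  have hv : monomial v (1 : K) ≠ 0 := by simp
  refine ⟨monomial v 1 * f, ⟨I.mul_mem_left _ hf.1, ?_⟩, mul_ne_zero hv hf0, ?_⟩
  · have h1 : monomial v (1 : K) ∈ homogeneousSubmodule (Fin n) K (expDeg v) :=
      mem_homogeneousSubmodule_iff.2 fun w hw => by
        rw [Finset.mem_singleton.1 (support_monomial_subset hw)]
    exact IsHomogeneous.mul h1 hf.2
  · rw [o.degree_mul hv hf0, o.degree_monomial]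
    simp

/-- `m` is not divisible by any of the pure powers. -/
def IsReducedExponent {n r : ℕ} (hrn : r ≤ n) (a : Fin r → ℕ) (m : Fin n → ℕ) : Prop :=
  ∀ i, m (Fin.castLE hrn i) < a i

/-- The side lengths `a` extended to all coordinates and truncated at `N`. -/
def boxSides {n r : ℕ} (a : Fin r → ℕ) (N : ℕ) (i : Fin n) : ℕ :=
  if h : (i : ℕ) < r then min (a ⟨i, h⟩) N else N

theorem boxSides_monotone {n r : ℕ} {a : Fin r → ℕ} (ha : Monotone a) (N : ℕ) :
    Monotone (boxSides (n := n) a N) := by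
  intro i j hij
  have hij' : (i : ℕ) ≤ j := hij
  unfold boxSides
  split_ifs with h1 h2 h2
  · exact min_le_min_right _ (ha hij')
  · exact min_le_right _ _
  · omega
  · exact le_rfl

theorem mem_level_boxSides {n r : ℕ} (hrn : r ≤ n) {a : Fin r → ℕ} {N d : ℕ} (hd : d < N)
    {m : Fin n → ℕ} :
    m ∈ level (boxSides a N) d ↔ IsReducedExponent hrn a m ∧ ∑ i, m i = d := by
  rw [mem_level]
  have hcast : ∑ i, (m i : ℤ) = d ↔ ∑ i, m i = d := by norm_cast
  rw [hcast]
  refine and_congr_left fun hsum => ⟨fun h i => ?_, fun h i => ?_⟩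
  · have := h (Fin.castLE hrn i)
    simp only [boxSides, Fin.val_castLE, Fin.is_lt, dite_true] at this
    exact this.trans_le (min_le_left _ _)
  · have h1 := Finset.single_le_sum (fun j _ => Nat.zero_le (m j)) (Finset.mem_univ i)
    unfold boxSides
    split_ifs with hi
    · exact lt_min (h ⟨i, hi⟩) (by omega)
    · omega

theorem level_boxSides_congr {n r : ℕ} (hrn : r ≤ n) (a : Fin r → ℕ) {N N' d : ℕ} (hd : d < N)
    (hdN : d < N') :
    level (n := n) (boxSides a N) d = level (boxSides a N') d := by
  ext m
  rw [mem_level_boxSides hrn hd, mem_level_boxSides hrn hdN]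

/-- Exponent vectors in `U` of a fixed degree are counted by those that are reduced. -/
theorem ncard_eq_of_isReducedExponent {n r d : ℕ} (hrn : r ≤ n) (a : Fin r → ℕ)
    {U : Set (Fin n →₀ ℕ)} (hU : U ⊆ {u | expDeg u = d})
    (hred : ∀ u : Fin n →₀ ℕ, expDeg u = d → ¬ IsReducedExponent hrn a u → u ∈ U)
    {S : Finset (Fin n → ℕ)} (hS : S ⊆ level (boxSides a (d + 1)) d)
    (hSU : ∀ u : Fin n →₀ ℕ, ⇑u ∈ level (boxSides a (d + 1)) d → (u ∈ U ↔ ⇑u ∈ S)) :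
    U.ncard = {u : Fin n →₀ ℕ | expDeg u = d ∧ ¬ IsReducedExponent hrn a u}.ncard + S.card := by
  have hlev : ∀ u : Fin n →₀ ℕ, ⇑u ∈ level (boxSides a (d + 1)) d ↔
      IsReducedExponent hrn a u ∧ expDeg u = d :=
    fun u => mem_level_boxSides hrn (Nat.lt_succ_self d)
  have hcard : ((fun u : Fin n →₀ ℕ => ⇑u) ⁻¹' (S : Set (Fin n → ℕ))).ncard = S.card := by
    rw [Set.ncard_preimage_of_injective_subset_range DFunLike.coe_injective,
      Set.ncard_coe_finset]
    exact fun m _ => ⟨Finsupp.equivFunOnFinite.symm m, by simp⟩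
  have heq : U = {u : Fin n →₀ ℕ | expDeg u = d ∧ ¬ IsReducedExponent hrn a u} ∪
      (fun u : Fin n →₀ ℕ => ⇑u) ⁻¹' (S : Set (Fin n → ℕ)) := by
    ext u
    simp only [Set.mem_union, Set.mem_ofPred_eq, Set.mem_preimage, Finset.mem_coe]
    constructor
    · intro hu
      by_cases h : IsReducedExponent hrn a u
      · exact Or.inr ((hSU u ((hlev u).2 ⟨h, hU hu⟩)).1 hu)
      · exact Or.inl ⟨hU hu, h⟩
    · rintro (h | h)
      · exact hred u h.1 h.2
      · exact (hSU u (hS h)).2 h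
  rw [heq, Set.ncard_union_eq ?_ ((finite_expDeg_eq n d).subset fun u hu => hu.1)
    (S.finite_toSet.preimage DFunLike.coe_injective.injOn), hcard]
  rw [Set.disjoint_left]
  intro u h1 h2
  exact h1.2 ((hlev u).1 (hS h2)).1

theorem monomial_mem_purePowers {n r : ℕ} {K : Type*} [Field K] (hrn : r ≤ n) {a : Fin r → ℕ}
    {u : Fin n →₀ ℕ} (hu : ¬ IsReducedExponent hrn a u) (c : K) :
    monomial u c ∈ purePowers K hrn a := by
  simp only [IsReducedExponent, not_forall, not_lt] at hu
  obtain ⟨i, hi⟩ := hu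
  have hle : Finsupp.single (Fin.castLE hrn i) (a i) ≤ u := by
    rwa [Finsupp.single_le_iff]
  have h : monomial u c = monomial (u - Finsupp.single (Fin.castLE hrn i) (a i)) c *
      X (Fin.castLE hrn i) ^ a i := by
    rw [X_pow_eq_monomial, monomial_mul, mul_one, tsub_add_cancel_of_le hle]
  rw [h]
  exact Ideal.mul_mem_left _ _ (Ideal.subset_span ⟨i, rfl⟩)

/-- Lex segments in the reduced monomials of each degree that are compatible with shadows
generate, together with the pure powers, a lex-plus-powers ideal. -/
theorem exists_isLPP_of_isSeg {n r : ℕ} (K : Type*) [Field K] (o : MonomialOrder (Fin n))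
    (hrn : r ≤ n) (a : Fin r → ℕ) (T : ℕ → Finset (Fin n → ℕ))
    (hT : ∀ d : ℕ, IsSeg (boxSides a (d + 1)) d (T d))
    (hshadow : ∀ d : ℕ, shadow (boxSides a (d + 2)) ((d : ℤ) + 1) (T d) ⊆ T (d + 1)) :
    ∃ J : Ideal (MvPolynomial (Fin n) K), IsLPP hrn a J ∧
      ∀ d, leadSet o (component J d) =
        {u | expDeg u = d ∧ (¬ IsReducedExponent hrn a u ∨ ⇑u ∈ T d)} := by
  let U : Set (Fin n →₀ ℕ) := {u | ¬ IsReducedExponent hrn a u ∨ ⇑u ∈ T (expDeg u)}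
  have hlev : ∀ (d : ℕ) (u : Fin n →₀ ℕ), ⇑u ∈ level (boxSides a (d + 1)) d ↔
      IsReducedExponent hrn a u ∧ expDeg u = d :=
    fun d u => mem_level_boxSides hrn (Nat.lt_succ_self d)
  have hstep : ∀ u ∈ U, ∀ i, u + Finsupp.single i 1 ∈ U := by
    intro u hu i
    by_cases hred : IsReducedExponent hrn a (u + Finsupp.single i 1 : Fin n →₀ ℕ)
    · right
      rw [expDeg_add, expDeg_single]
      have hle : (u : Fin n → ℕ) ≤ (u + Finsupp.single i 1 : Fin n →₀ ℕ) := fun j => by simp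
      have hu' := hu.resolve_left fun h => h fun k => (hle _).trans_lt (hred k)
      refine hshadow _ (mem_shadow.2 ⟨?_, _, hu', hle⟩)
      have := (hlev (expDeg u + 1) (u + Finsupp.single i 1)).2
        ⟨hred, by rw [expDeg_add, expDeg_single]⟩
      exact_mod_cast this
    · exact Or.inl hred
  have hadd : ∀ v : Fin n →₀ ℕ, ∀ u ∈ U, u + v ∈ U := by
    intro v
    induction v using Finsupp.induction_linear with
    | zero => intro u hu; simpa using hu
    | add v w hv hw => intro u hu; rw [← add_assoc]; exact hw _ (hv u hu)
    | single i k =>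
      induction k with
      | zero => intro u hu; simpa using hu
      | succ k ih =>
        intro u hu
        rw [Finsupp.single_add, ← add_assoc]
        exact hstep _ (ih u hu) i
  let J : Ideal (MvPolynomial (Fin n) K) := Ideal.span ((fun u => monomial u (1 : K)) '' U)
  have hJ : ∀ f : MvPolynomial (Fin n) K, f ∈ J ↔ ∀ u ∈ f.support, u ∈ U := by
    intro f
    rw [mem_ideal_span_monomial_image]
    refine forall₂_congr fun u _ => ⟨?_, fun h => ⟨u, h, le_rfl⟩⟩
    rintro ⟨v, hv, hle⟩
    rw [← add_tsub_cancel_of_le hle]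
    exact hadd _ v hv
  have hmon : ∀ u ∈ U, monomial u (1 : K) ∈ J := fun u hu => Ideal.subset_span ⟨u, hu, rfl⟩
  refine ⟨J, ⟨fun f hf d => ?_, fun d => ?_⟩, fun d => ?_⟩
  · rw [hJ] at hf ⊢
    intro u hu
    refine hf u ?_
    rw [mem_support_iff, coeff_homogeneousComponent] at hu
    rw [mem_support_iff]
    exact fun h => hu (by simp [h])
  · have hpure : purePowers K hrn a ≤ J := by
      refine Ideal.span_le.2 ?_
      rintro _ ⟨i, rfl⟩
      change X (Fin.castLE hrn i) ^ a i ∈ J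
      rw [X_pow_eq_monomial]
      refine hmon _ (Or.inl fun h => ?_)
      simpa using h i
    refine ⟨{m | expDeg m = d ∧ ∃ t ∈ T d, toLex t ≤ toLex ⇑m}, ⟨fun m hm => hm.1, ?_⟩,
      le_antisymm ?_ (sup_le ?_ ?_)⟩
    · rintro m ⟨-, t, ht, hle⟩ m' hm' hlex
      refine ⟨hm', t, ht, hle.trans ?_⟩
      rcases hlex with rfl | h
      · exact le_rfl
      · exact le_of_lt (toLex_lt_iff.2 h)
    · intro f hf
      rw [f.as_sum]
      refine Submodule.sum_mem _ fun u hu => ?_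
      have hdeg := mem_homogeneousSubmodule_iff.1 hf.2 u hu
      rcases (hJ f).1 hf.1 u hu with h | h
      · exact Submodule.mem_sup_right
          (monomial_mem_component (monomial_mem_purePowers hrn h _) hdeg)
      · refine Submodule.mem_sup_left ?_
        rw [← mul_one (coeff u f), ← smul_eq_mul, ← smul_monomial]
        exact Submodule.smul_mem _ _ (Submodule.subset_span
          ⟨u, ⟨hdeg, ⇑u, hdeg ▸ h, le_rfl⟩, rfl⟩)
    · rw [Submodule.span_le]
      rintro _ ⟨u, ⟨hdeg, t, ht, hle⟩, rfl⟩
      refine monomial_mem_component (hmon u ?_) hdeg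
      by_cases hred : IsReducedExponent hrn a u
      · right
        rw [hdeg]
        rcases hle.lt_or_eq with h | h
        · exact (hT d).2 t ht _ ((hlev d u).2 ⟨hred, hdeg⟩) h
        · rw [toLex_inj] at h
          exact h ▸ ht
      · exact Or.inl hred
    · exact fun f hf => ⟨hpure hf.1, hf.2⟩
  · ext u
    constructor
    · intro hu
      have hdeg : expDeg u = d := leadSet_component_subset o J d hu
      obtain ⟨f, hf, hf0, rfl⟩ := hu
      refine ⟨hdeg, ?_⟩
      have := (hJ f).1 hf.1 _ (o.degree_mem_support hf0)
      rwa [Set.mem_ofPred_eq, hdeg] at this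
    · rintro ⟨rfl, h⟩
      exact mem_leadSet_of_monomial_mem o (hmon u h)

end ClementsLindstrom

open ClementsLindstrom in
/-- **Clements–Lindström.** If a homogeneous ideal `I ⊆ K[x_1,…,x_n]` contains the
pure-powers ideal `(x_1^{a_1},…,x_r^{a_r})` of a degree sequence `a`, then there is an
`a`-lpp ideal `J` with the same Hilbert function as `I`. -/
theorem clements_lindstrom {K : Type*} [Field K] {n r : ℕ} (hrn : r ≤ n)
    (a : Fin r → ℕ) (hpos : ∀ i, 0 < a i) (hmono : Monotone a)
    (I : Ideal (MvPolynomial (Fin n) K)) (hI : IsHomog I)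
    (hPP : purePowers K hrn a ≤ I) :
    ∃ J : Ideal (MvPolynomial (Fin n) K), IsLPP hrn a J ∧ ∀ d : ℕ, hilb J d = hilb I d := by
  classical
  let o : MonomialOrder (Fin n) := MonomialOrder.lex
  let lead : ℕ → Set (Fin n →₀ ℕ) := fun d => leadSet o (component I d)
  let S : ℕ → Finset (Fin n → ℕ) := fun d =>
    (level (boxSides a (d + 1)) d).filter fun m => Finsupp.equivFunOnFinite.symm m ∈ lead d
  have hS : ∀ d, S d ⊆ level (boxSides a (d + 1)) d := fun d => Finset.filter_subset _ _
  have hSmem : ∀ d (u : Fin n →₀ ℕ), ⇑u ∈ level (boxSides a (d + 1)) d →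
      (u ∈ lead d ↔ ⇑u ∈ S d) := by
    intro d u hu
    rw [Finset.mem_filter, Finsupp.equivFunOnFinite_symm_coe]
    exact (and_iff_right hu).symm
  choose T hT hTS using fun d : ℕ => exists_isSeg_card (n := n) (boxSides a (d + 1)) d
    (S d).card (Finset.card_le_card (hS d))
  have hshadow : ∀ d : ℕ, shadow (boxSides a (d + 2)) ((d : ℤ) + 1) (T d) ⊆ T (d + 1) := by
    intro d
    have hcongr := level_boxSides_congr (n := n) hrn a (N := d + 1) (N' := d + 2) (d := d)
      (by omega) (by omega)
    have hTd : IsSeg (boxSides a (d + 2)) d (T d) := by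
      have := hT d
      rwa [IsSeg, hcongr] at this
    have hmin := shadowMinimal_of_monotone (boxSides_monotone (n := n) hmono (d + 2)) d (S d) (T d)
      (hcongr ▸ hS d) hTd (hTS d).le
    have hTd' := hT (d + 1)
    push_cast at hTd'
    refine hTd.shadow.subset_of_card_le hTd' (hmin.trans ?_)
    rw [hTS]
    refine Finset.card_le_card fun m hm => ?_
    rw [mem_shadow] at hm
    obtain ⟨hm, s, hs, hle⟩ := hm
    obtain ⟨u, rfl⟩ : ∃ u : Fin n →₀ ℕ, ⇑u = m := ⟨Finsupp.equivFunOnFinite.symm m, by simp⟩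
    obtain ⟨v, rfl⟩ : ∃ v : Fin n →₀ ℕ, ⇑v = s := ⟨Finsupp.equivFunOnFinite.symm s, by simp⟩
    have hm' : ⇑u ∈ level (boxSides a (d + 1 + 1)) ((d + 1 : ℕ) : ℤ) := by exact_mod_cast hm
    rw [← hSmem (d + 1) u hm']
    have hlead := leadSet_mul o ((hSmem d v (hS d hs)).2 hs) (u - v)
    have hle' : v ≤ u := hle
    have hdv : expDeg v = d :=
      ((mem_level_boxSides hrn (Nat.lt_succ_self d)).1 (hS d hs)).2
    have hdu : expDeg u = d + 1 :=
      ((mem_level_boxSides hrn (Nat.lt_succ_self (d + 1))).1 hm').2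
    have hsum : u - v + v = u := tsub_add_cancel_of_le hle'
    have hdeg : expDeg (u - v) + d = d + 1 := by
      rw [← hdu, ← hdv, ← expDeg_add, hsum]
    rwa [hdeg, hsum] at hlead
  obtain ⟨J, hJ, hJlead⟩ := exists_isLPP_of_isSeg K o hrn a T hT hshadow
  refine ⟨J, hJ, fun d => ?_⟩
  have hlev : ∀ u : Fin n →₀ ℕ, ⇑u ∈ level (boxSides a (d + 1)) d →
      (u ∈ leadSet o (component J d) ↔ ⇑u ∈ T d) := by
    intro u hu
    have h := (mem_level_boxSides hrn (Nat.lt_succ_self d)).1 hu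
    rw [hJlead]
    exact ⟨fun h' => h'.2.resolve_left (not_not.2 h.1), fun h' => ⟨h.2, Or.inr h'⟩⟩
  rw [hilb_eq_ncard_leadSet o, hilb_eq_ncard_leadSet o,
    ncard_eq_of_isReducedExponent hrn a (leadSet_component_subset o J d) ?_ (hT d).1 hlev,
    ncard_eq_of_isReducedExponent hrn a (leadSet_component_subset o I d) ?_ (hS d) (hSmem d), hTS]
  · rintro u rfl hu
    exact mem_leadSet_of_monomial_mem o (hPP (monomial_mem_purePowers hrn hu 1))
  · rintro u rfl hu
    rw [hJlead]
    exact ⟨rfl, Or.inl hu⟩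
end

section
/- (Strong hyperplane restriction, Gasharov) Let a = (a_1,…,a_r) be a degree sequence and let I ⊆ A = K[x_1,…,x_n] be an a-spp ideal. Let J be the a-lpp ideal with the same Hilbert function as I (which exists by the Clements–Lindström theorem). Then for every integer i > 0 and every degree d ≥ 0, dim_K (I + (x_n^i))_d ≥ dim_K (J + (x_n^i))_d. -/
open MvPolynomial

section BoxCombinatorics

open Finset

open scoped Classical

/-- Exponent sequences of degree `d` supported on the first `n` variables and bounded by `c`. -/
def cappedBoxSet (c : ℕ → ℕ) (n d : ℕ) : Set (ℕ → ℕ) :=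
  {m | (∀ i < n, m i ≤ c i) ∧ (∀ i, n ≤ i → m i = 0) ∧ ∑ i ∈ range n, m i = d}

lemma cappedBoxSet_finite (c : ℕ → ℕ) (n d : ℕ) : (cappedBoxSet c n d).Finite := by
  refine Set.Finite.of_injOn (f := fun m (i : Fin n) => m i)
    (t := Set.Iic fun i : Fin n => c i) ?_ ?_ (Set.finite_Iic _)
  · intro m hm i
    exact hm.1 i i.2
  · intro m hm m' hm' h
    funext i
    by_cases hi : i < n
    · exact congrFun h ⟨i, hi⟩
    · rw [hm.2.1 i (not_lt.1 hi), hm'.2.1 i (not_lt.1 hi)]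

/-- `cappedBoxSet` as a finset. -/
noncomputable def cappedBox (c : ℕ → ℕ) (n d : ℕ) : Finset (ℕ → ℕ) :=
  (cappedBoxSet_finite c n d).toFinset

lemma mem_cappedBox {c : ℕ → ℕ} {n d : ℕ} {m : ℕ → ℕ} : m ∈ cappedBox c n d ↔
    (∀ i < n, m i ≤ c i) ∧ (∀ i, n ≤ i → m i = 0) ∧ ∑ i ∈ range n, m i = d := by
  simp [cappedBox, cappedBoxSet]

/-- Strongly stable subsets of the box. -/
def BoxStable (c : ℕ → ℕ) (n d : ℕ) (U : Finset (ℕ → ℕ)) : Prop :=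
  U ⊆ cappedBox c n d ∧ ∀ u ∈ U, ∀ v ∈ cappedBox c n d, ∀ i j, j < i →
    v + Pi.single i 1 = u + Pi.single j 1 → v ∈ U

/-- Lex-segments of the box. -/
def BoxLex (c : ℕ → ℕ) (n d : ℕ) (V : Finset (ℕ → ℕ)) : Prop :=
  V ⊆ cappedBox c n d ∧ ∀ u ∈ V, ∀ v ∈ cappedBox c n d, toLex u ≤ toLex v → v ∈ V

/-- The multiples `x_i u`, `u ∈ U`, lying in the degree-`d` part of the box. -/
noncomputable def boxShadow (c : ℕ → ℕ) (n d : ℕ) (U : Finset (ℕ → ℕ)) : Finset (ℕ → ℕ) :=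
  {w ∈ cappedBox c n d | ∃ u ∈ U, ∃ i, w = u + Pi.single i 1}

lemma mem_boxShadow {c : ℕ → ℕ} {n d : ℕ} {U : Finset (ℕ → ℕ)} {w : ℕ → ℕ} :
    w ∈ boxShadow c n d U ↔ w ∈ cappedBox c n d ∧ ∃ u ∈ U, ∃ i, w = u + Pi.single i 1 := by
  simp [boxShadow]

/-- The elements of `U` whose exponent at `n` is `k`, with that exponent removed. -/
noncomputable def lastSlice (n k : ℕ) (U : Finset (ℕ → ℕ)) : Finset (ℕ → ℕ) :=
  {u ∈ U | u n = k}.image fun u => Function.update u n 0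

lemma mem_lastSlice {n k : ℕ} {U : Finset (ℕ → ℕ)} {m : ℕ → ℕ} :
    m ∈ lastSlice n k U ↔ m n = 0 ∧ Function.update m n k ∈ U := by
  simp only [lastSlice, mem_image, mem_filter]
  constructor
  · rintro ⟨u, ⟨hu, rfl⟩, rfl⟩
    simpa using hu
  · rintro ⟨h, hm⟩
    exact ⟨_, ⟨hm, by simp⟩, by simp [← h]⟩

lemma card_lastSlice (n k : ℕ) (U : Finset (ℕ → ℕ)) : #(lastSlice n k U) = #{u ∈ U | u n = k} := by
  refine card_image_of_injOn fun u hu v hv h => ?_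
  have hu' : u n = k := by simpa using (mem_filter.1 hu).2
  have hv' : v n = k := by simpa using (mem_filter.1 hv).2
  funext i
  by_cases hi : i = n
  · rw [hi, hu', hv']
  · simpa [Function.update_of_ne hi] using congrFun h i

lemma card_filter_lt (n i : ℕ) (U : Finset (ℕ → ℕ)) :
    #{u ∈ U | u n < i} = ∑ k ∈ range i, #(lastSlice n k U) := by
  rw [card_eq_sum_card_fiberwise (f := fun u => u n) (t := range i)]
  · refine sum_congr rfl fun k hk => ?_
    rw [card_lastSlice, filter_filter]
    congr 1
    ext u
    simp only [mem_filter]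
    have := mem_range.1 hk
    grind
  · intro u hu
    simpa using (mem_filter.1 hu).2

lemma toLex_lt_iff {u v : ℕ → ℕ} :
    toLex u < toLex v ↔ ∃ j, (∀ t < j, u t = v t) ∧ u j < v j := Iff.rfl

lemma eq_of_mem_cappedBox_of_le {c : ℕ → ℕ} {n d : ℕ} {u v : ℕ → ℕ} (hu : u ∈ cappedBox c n d)
    (hv : v ∈ cappedBox c n d) (h : ∀ i < n, u i ≤ v i) : u = v := by
  rw [mem_cappedBox] at hu hv
  have := (sum_eq_sum_iff_of_le (s := range n) (f := u) (g := v)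
    fun i hi => h i (mem_range.1 hi)).1 (by rw [hu.2.2, hv.2.2])
  funext i
  by_cases hi : i < n
  · exact this i (mem_range.2 hi)
  · rw [hu.2.1 i (not_lt.1 hi), hv.2.1 i (not_lt.1 hi)]

lemma lt_of_ne_zero_of_mem_cappedBox {c : ℕ → ℕ} {n d : ℕ} {u : ℕ → ℕ} (hu : u ∈ cappedBox c n d)
    {i : ℕ} (hi : u i ≠ 0) : i < n := by
  by_contra h
  exact hi ((mem_cappedBox.1 hu).2.1 i (not_lt.1 h))

lemma exists_eq_add_single {c : ℕ → ℕ} {n d : ℕ} {w : ℕ → ℕ} (hw : w ∈ cappedBox c n (d + 1))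
    {s : ℕ} (hs : w s ≠ 0) : ∃ u ∈ cappedBox c n d, w = u + Pi.single s 1 := by
  have hsn := lt_of_ne_zero_of_mem_cappedBox hw hs
  have hw' : w = w - Pi.single s 1 + Pi.single s 1 := by
    funext i
    by_cases hi : i = s
    · subst hi
      simp
      omega
    · simp [hi]
  refine ⟨w - Pi.single s 1, ?_, hw'⟩
  rw [mem_cappedBox] at hw ⊢
  refine ⟨fun i hi => (Nat.sub_le _ _).trans (hw.1 i hi), fun i hi => ?_, ?_⟩
  · simp [hw.2.1 i hi]
  · have h := hw.2.2
    rw [hw'] at h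
    simp only [Pi.add_apply, sum_add_distrib, sum_pi_single', mem_range, hsn, if_true] at h
    omega

lemma add_single_mem_cappedBox {c : ℕ → ℕ} {n d : ℕ} {u : ℕ → ℕ} (hu : u ∈ cappedBox c n d) {s : ℕ}
    (hs : s < n) (h : u s < c s) : u + Pi.single s 1 ∈ cappedBox c n (d + 1) := by
  rw [mem_cappedBox] at hu ⊢
  refine ⟨fun i hi => ?_, fun i hi => ?_, ?_⟩
  · by_cases his : i = s
    · subst his
      simpa using h
    · simpa [his] using hu.1 i hi
  · have : i ≠ s := by omega
    simpa [this] using hu.2.1 i hi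
  · simp [sum_add_distrib, sum_pi_single', hs, hu.2.2]

lemma BoxLex.boxStable {c : ℕ → ℕ} {n d : ℕ} {V : Finset (ℕ → ℕ)} (hV : BoxLex c n d V) :
    BoxStable c n d V := by
  refine ⟨hV.1, fun u hu v hv i j hji h => hV.2 u hu v hv (le_of_lt ?_)⟩
  refine toLex_lt_iff.2 ⟨j, fun t ht => ?_, ?_⟩
  · have := congrFun h t
    have h1 : t ≠ i := by omega
    have h2 : t ≠ j := by omega
    simpa [h1, h2] using this.symm
  · have := congrFun h j
    have h1 : j ≠ i := by omega
    simp [h1] at this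
    omega

lemma BoxLex.subset_of_card_le {c : ℕ → ℕ} {n d : ℕ} {V W : Finset (ℕ → ℕ)}
    (hV : BoxLex c n d V) (hW : BoxLex c n d W) (h : #V ≤ #W) : V ⊆ W := by
  by_contra hne
  obtain ⟨v, hv, hvW⟩ := not_subset.1 hne
  have hWV : W ⊆ V := fun w hw => by
    rcases le_total (toLex v) (toLex w) with h1 | h1
    · exact hV.2 v hv w (hW.1 hw) h1
    · exact absurd (hW.2 w hw v (hV.1 hv) h1) hvW
  exact hvW ((eq_of_subset_of_card_le hWV h).symm ▸ hv)

lemma exists_boxLex_card (c : ℕ → ℕ) (n d : ℕ) {k : ℕ} (hk : k ≤ #(cappedBox c n d)) :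
    ∃ V, BoxLex c n d V ∧ #V = k := by
  induction k with
  | zero => exact ⟨∅, ⟨by simp, by simp⟩, rfl⟩
  | succ k ih =>
    obtain ⟨V, hV, hVk⟩ := ih (by omega)
    have hne : (cappedBox c n d \ V).Nonempty := by
      rw [sdiff_nonempty]
      intro h
      have := card_le_card h
      omega
    obtain ⟨x, hx, hmax⟩ := exists_max_image (cappedBox c n d \ V) toLex hne
    rw [mem_sdiff] at hx
    refine ⟨insert x V, ⟨insert_subset hx.1 hV.1, fun u hu v hv huv => ?_⟩, ?_⟩
    · rw [mem_insert] at hu ⊢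
      by_cases hvV : v ∈ V
      · exact Or.inr hvV
      · rcases hu with rfl | hu
        · exact Or.inl (toLex.injective
            (le_antisymm (hmax v (mem_sdiff.2 ⟨hv, hvV⟩)) huv))
        · exact Or.inr (hV.2 u hu v hv huv)
    · rw [card_insert_of_notMem hx.2, hVk]

lemma BoxLex.boxShadow_boxLex {c : ℕ → ℕ} {n d : ℕ} {V : Finset (ℕ → ℕ)} (hV : BoxLex c n d V) :
    BoxLex c n (d + 1) (boxShadow c n (d + 1) V) := by
  refine ⟨filter_subset _ _, fun w hw w' hw' hle => ?_⟩
  obtain ⟨hwb, u, hu, i, hwu⟩ := mem_boxShadow.1 hw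
  rcases hle.eq_or_lt with h | hlt
  · rwa [← toLex.injective h]
  obtain ⟨j, hj, hjlt⟩ := toLex_lt_iff.1 hlt
  have key : ∃ s u', w' = u' + Pi.single s 1 ∧ u' ∈ cappedBox c n d ∧ toLex u ≤ toLex u' := by
    have hui : ∀ t, t ≠ i → w t = u t := fun t ht => by rw [hwu]; simp [ht]
    have huii : w i = u i + 1 := by rw [hwu]; simp
    by_cases hs : ∃ s, j < s ∧ w' s ≠ 0
    · obtain ⟨s, hjs, hs⟩ := hs
      obtain ⟨u', hu', rfl⟩ := exists_eq_add_single hw' hs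
      refine ⟨s, u', rfl, hu', le_of_lt ?_⟩
      have hu's : ∀ t ≤ j, (u' + Pi.single s 1 : ℕ → ℕ) t = u' t := fun t ht => by
        have : t ≠ s := by omega
        simp [this]
      refine toLex_lt_iff.2 ?_
      by_cases hij : i < j
      · refine ⟨i, fun t ht => ?_, ?_⟩
        · rw [← hui t (by omega), hj t (by omega), hu's t (by omega)]
        · have := hj i hij
          rw [hu's i (by omega)] at this
          omega
      · refine ⟨j, fun t ht => ?_, ?_⟩
        · rw [← hui t (by omega), hj t (by omega), hu's t (by omega)]
        · rw [hu's j le_rfl] at hjlt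
          by_cases hji : j = i
          · subst hji
            omega
          · rw [hui j hji] at hjlt
            exact hjlt
    · push Not at hs
      obtain ⟨u', hu', rfl⟩ := exists_eq_add_single hw' (s := j) (by omega)
      refine ⟨j, u', rfl, hu', ?_⟩
      have hu's : ∀ t, t ≠ j → (u' + Pi.single j 1 : ℕ → ℕ) t = u' t := fun t ht => by simp [ht]
      have hu'j : (u' + Pi.single j 1 : ℕ → ℕ) j = u' j + 1 := by simp
      rcases lt_trichotomy i j with hij | hij | hij
      · refine le_of_lt (toLex_lt_iff.2 ⟨i, fun t ht => ?_, ?_⟩)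
        · rw [← hui t (by omega), hj t (by omega), hu's t (by omega)]
        · have := hj i hij
          rw [hu's i (by omega)] at this
          omega
      · subst hij
        refine le_of_lt (toLex_lt_iff.2 ⟨i, fun t ht => ?_, ?_⟩)
        · rw [← hui t (by omega), hj t (by omega), hu's t (by omega)]
        · omega
      · have hlow : ∀ t < j, u t = u' t := fun t ht => by
          rw [← hui t (by omega), hj t (by omega), hu's t (by omega)]
        have hujj := hui j (by omega)
        by_cases hlt' : u j < u' j
        · exact le_of_lt (toLex_lt_iff.2 ⟨j, hlow, hlt'⟩)
        · refine le_of_eq (congrArg toLex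
            (eq_of_mem_cappedBox_of_le hu' (hV.1 hu) fun t _ => ?_).symm)
          rcases lt_trichotomy t j with h | h | h
          · exact (hlow t h).ge
          · subst h
            omega
          · have := hs t h
            rw [hu's t (by omega)] at this
            omega
  obtain ⟨s, u', rfl, hu', hle'⟩ := key
  exact mem_boxShadow.2 ⟨hw', u', hV.2 u hu u' hu' hle', s, rfl⟩

lemma exists_add_single_le {c : ℕ → ℕ} {n d e : ℕ} {z w : ℕ → ℕ} (hz : z ∈ cappedBox c n d)
    (hw : w ∈ cappedBox c n e) (hde : d < e) (h : toLex z < toLex w) :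
    ∃ t, z + Pi.single t 1 ∈ cappedBox c n (d + 1) ∧ toLex (z + Pi.single t 1) ≤ toLex w := by
  obtain ⟨j, hj, hjlt⟩ := toLex_lt_iff.1 h
  have hjn : j < n := lt_of_ne_zero_of_mem_cappedBox hw (by omega)
  have hjc : z j < c j := hjlt.trans_le ((mem_cappedBox.1 hw).1 j hjn)
  by_cases ht : ∃ t, j < t ∧ t < n ∧ z t < c t
  · obtain ⟨t, hjt, htn, htc⟩ := ht
    refine ⟨t, add_single_mem_cappedBox hz htn htc,
      le_of_lt (toLex_lt_iff.2 ⟨j, fun s hs => ?_, ?_⟩)⟩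
    · have : s ≠ t := by omega
      simpa [this] using hj s hs
    · have : j ≠ t := by omega
      simpa [this] using hjlt
  · push Not at ht
    have hz' := add_single_mem_cappedBox hz hjn hjc
    refine ⟨j, hz', ?_⟩
    have hlow : ∀ s < j, (z + Pi.single j 1 : ℕ → ℕ) s = w s := fun s hs => by
      have : s ≠ j := by omega
      simpa [this] using hj s hs
    have hzj : (z + Pi.single j 1 : ℕ → ℕ) j = z j + 1 := by simp
    by_cases hlt : z j + 1 < w j
    · exact le_of_lt (toLex_lt_iff.2 ⟨j, hlow, by omega⟩)
    · have hwz : ∀ s < n, w s ≤ (z + Pi.single j 1 : ℕ → ℕ) s := fun s hs => by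
        rcases lt_trichotomy s j with h | h | h
        · exact (hlow s h).ge
        · subst h
          omega
        · have : s ≠ j := by omega
          simpa [this] using ((mem_cappedBox.1 hw).1 s hs).trans (ht s h hs)
      have hsum := sum_le_sum fun s (hs : s ∈ range n) => hwz s (mem_range.1 hs)
      rw [(mem_cappedBox.1 hw).2.2, (mem_cappedBox.1 hz').2.2] at hsum
      obtain rfl : e = d + 1 := by omega
      exact le_of_eq (congrArg toLex (eq_of_mem_cappedBox_of_le hw hz' hwz).symm)

lemma update_mem_cappedBox {c : ℕ → ℕ} {n d k : ℕ} {m : ℕ → ℕ} (hm : m ∈ cappedBox c n d)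
    (hk : k ≤ c n) :
    Function.update m n k ∈ cappedBox c (n + 1) (d + k) := by
  rw [mem_cappedBox] at hm ⊢
  refine ⟨fun i hi => ?_, fun i hi => ?_, ?_⟩
  · by_cases hin : i = n
    · subst hin
      simpa using hk
    · simpa [hin] using hm.1 i (by omega)
  · have : i ≠ n := by omega
    simpa [this] using hm.2.1 i (by omega)
  · rw [sum_range_succ, ← hm.2.2]
    congr 1
    · refine sum_congr rfl fun i hi => ?_
      have : i ≠ n := by have := mem_range.1 hi; omega
      simp [this]
    · simp

lemma mem_cappedBox_of_update {c : ℕ → ℕ} {n d k : ℕ} {m : ℕ → ℕ} (hmn : m n = 0)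
    (hm : Function.update m n k ∈ cappedBox c (n + 1) (d + k)) : m ∈ cappedBox c n d ∧ k ≤ c n := by
  rw [mem_cappedBox] at hm
  have hne : ∀ i, i ≠ n → Function.update m n k i = m i := fun i hi => by simp [hi]
  refine ⟨mem_cappedBox.2 ⟨fun i hi => ?_, fun i hi => ?_, ?_⟩, by simpa using hm.1 n (by omega)⟩
  · rw [← hne i (by omega)]
    exact hm.1 i (by omega)
  · rcases hi.eq_or_lt with rfl | hi
    · exact hmn
    · rw [← hne i (by omega)]
      exact hm.2.1 i hi
  · have h := hm.2.2
    rw [sum_range_succ, sum_congr rfl fun i hi => hne i (by have := mem_range.1 hi; omega)] at h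
    simpa using h

lemma lastSlice_subset_cappedBox {c : ℕ → ℕ} {n d k : ℕ} {U : Finset (ℕ → ℕ)}
    (hU : U ⊆ cappedBox c (n + 1) (d + k)) : lastSlice n k U ⊆ cappedBox c n d := fun _ hm =>
  have h := mem_lastSlice.1 hm
  (mem_cappedBox_of_update h.1 (hU h.2)).1

lemma update_add_single {n k i : ℕ} (h : i ≠ n) (m : ℕ → ℕ) :
    Function.update (m + Pi.single i 1) n k = Function.update m n k + Pi.single i 1 := by
  funext t
  by_cases ht : t = n
  · subst ht
    simp [h.symm]
  · simp [ht]

lemma update_succ {n k : ℕ} (m : ℕ → ℕ) :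
    Function.update m n (k + 1) = Function.update m n k + Pi.single n 1 := by
  funext t
  by_cases ht : t = n
  · subst ht
    simp
  · simp [ht]

lemma BoxStable.lastSlice_boxStable {c : ℕ → ℕ} {n d k : ℕ} {U : Finset (ℕ → ℕ)}
    (hU : BoxStable c (n + 1) (d + k) U) : BoxStable c n d (lastSlice n k U) := by
  refine ⟨lastSlice_subset_cappedBox hU.1, fun u hu v hv i j hji h => ?_⟩
  obtain ⟨hun, hu⟩ := mem_lastSlice.1 hu
  have hk := (mem_cappedBox_of_update hun (hU.1 hu)).2
  have hvn := (mem_cappedBox.1 hv).2.1 n le_rfl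
  have hin : i < n := by
    by_contra hin
    have h1 := congrFun h i
    have h2 : i ≠ j := by omega
    have h3 : u i = 0 :=
      (mem_cappedBox.1 (mem_cappedBox_of_update hun (hU.1 hu)).1).2.1 i (not_lt.1 hin)
    simp [h2, h3] at h1
  refine mem_lastSlice.2 ⟨hvn, hU.2 _ hu _ (update_mem_cappedBox hv hk) i j hji ?_⟩
  rw [← update_add_single (by omega), ← update_add_single (by omega), h]

lemma BoxLex.lastSlice_boxLex {c : ℕ → ℕ} {n d k : ℕ} {V : Finset (ℕ → ℕ)}
    (hV : BoxLex c (n + 1) (d + k) V) : BoxLex c n d (lastSlice n k V) := by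
  refine ⟨lastSlice_subset_cappedBox hV.1, fun u hu v hv h => ?_⟩
  rcases h.eq_or_lt with h | h
  · rwa [← toLex.injective h]
  obtain ⟨hun, hu⟩ := mem_lastSlice.1 hu
  have hk := (mem_cappedBox_of_update hun (hV.1 hu)).2
  have hvn := (mem_cappedBox.1 hv).2.1 n le_rfl
  refine mem_lastSlice.2 ⟨hvn, hV.2 _ hu _ (update_mem_cappedBox hv hk) (le_of_lt ?_)⟩
  obtain ⟨j, hj, hjlt⟩ := toLex_lt_iff.1 h
  have hjn : j < n := lt_of_ne_zero_of_mem_cappedBox hv (by omega)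
  refine toLex_lt_iff.2 ⟨j, fun t ht => ?_, ?_⟩
  · have : t ≠ n := by omega
    simpa [this] using hj t ht
  · simpa [hjn.ne] using hjlt

lemma BoxStable.boxShadow_lastSlice_subset {c : ℕ → ℕ} {n d k : ℕ} {U : Finset (ℕ → ℕ)}
    (hU : BoxStable c (n + 1) (d + (k + 1)) U) :
    boxShadow c n (d + 1) (lastSlice n (k + 1) U) ⊆ lastSlice n k U := by
  intro w hw
  obtain ⟨hwb, u, hu, i, rfl⟩ := mem_boxShadow.1 hw
  obtain ⟨hun, hu⟩ := mem_lastSlice.1 hu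
  have hk := (mem_cappedBox_of_update hun (hU.1 hu)).2
  have hin : i < n := lt_of_ne_zero_of_mem_cappedBox hwb (by simp)
  refine mem_lastSlice.2 ⟨(mem_cappedBox.1 hwb).2.1 n le_rfl, hU.2 _ hu _ ?_ n i hin ?_⟩
  · have := update_mem_cappedBox hwb (k := k) (by omega)
    rwa [add_assoc, add_comm 1 k] at this
  · rw [update_add_single hin.ne, update_succ]
    abel

/-- The Clements–Lindström inequality for stable sets in `n` variables. -/
def ShadowMono (c : ℕ → ℕ) (n : ℕ) : Prop :=
  ∀ d U V, BoxStable c n d U → BoxLex c n d V → #V ≤ #U →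
    #(boxShadow c n (d + 1) V) ≤ #(boxShadow c n (d + 1) U)

lemma mem_of_iterated_shadow {c : ℕ → ℕ} {n d : ℕ} {L : ℕ → Finset (ℕ → ℕ)}
    (hL : ∀ k ≤ d, BoxLex c n (d - k) (L k))
    (hsh : ∀ k < d, boxShadow c n (d - k) (L (k + 1)) ⊆ L k) {k s : ℕ} (hks : k + s ≤ d)
    {z w : ℕ → ℕ} (hz : z ∈ L (k + s)) (hw : w ∈ cappedBox c n (d - k)) (h : toLex z ≤ toLex w) :
    w ∈ L k := by
  induction s generalizing z with
  | zero => exact (hL k (by omega)).2 z hz w hw h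
  | succ s ih =>
    have hzb := (hL _ hks).1 hz
    have hne : z ≠ w := by
      rintro rfl
      have h1 := (mem_cappedBox.1 hzb).2.2
      have h2 := (mem_cappedBox.1 hw).2.2
      omega
    obtain ⟨t, ht, hle⟩ := exists_add_single_le hzb hw (by omega)
      (lt_of_le_of_ne h fun h' => hne (toLex.injective h'))
    refine ih (by omega) (hsh (k + s) (by omega) ?_) hle
    rw [show d - (k + (s + 1)) + 1 = d - (k + s) by omega] at ht
    exact mem_boxShadow.2 ⟨ht, z, hz, t, rfl⟩

/-- Strong hyperplane restriction for stable sets in a box. -/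
lemma ShadowMono.card_filter_lt_le {c : ℕ → ℕ} {n : ℕ} (hn : ShadowMono c n) {d : ℕ}
    {U V : Finset (ℕ → ℕ)} (hU : BoxStable c (n + 1) d U) (hV : BoxLex c (n + 1) d V)
    (hcard : #V ≤ #U) (i : ℕ) : #{v ∈ V | v n < i} ≤ #{u ∈ U | u n < i} := by
  have hU' : ∀ k ≤ d, BoxStable c (n + 1) (d - k + k) U := fun k hk => by
    rwa [Nat.sub_add_cancel hk]
  have hV' : ∀ k ≤ d, BoxLex c (n + 1) (d - k + k) V := fun k hk => by
    rwa [Nat.sub_add_cancel hk]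
  have hex : ∀ k, ∃ L, k ≤ d → BoxLex c n (d - k) L ∧ #L = #(lastSlice n k U) := fun k => by
    by_cases hk : k ≤ d
    · obtain ⟨L, hL⟩ := exists_boxLex_card c n (d - k)
        (card_le_card (lastSlice_subset_cappedBox (hU' k hk).1))
      exact ⟨L, fun _ => hL⟩
    · exact ⟨∅, fun h => absurd h hk⟩
  choose L hL using hex
  have hsh : ∀ k < d, boxShadow c n (d - k) (L (k + 1)) ⊆ L k := fun k hk => by
    have hd : d - (k + 1) + 1 = d - k := by omega
    have h1 := hn _ _ _ (hU' (k + 1) hk).lastSlice_boxStable (hL (k + 1) hk).1 (hL (k + 1) hk).2.le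
    have h2 := (hL (k + 1) hk).1.boxShadow_boxLex
    have h3 := card_le_card (hU' (k + 1) hk).boxShadow_lastSlice_subset
    rw [hd] at h1 h2 h3
    exact h2.subset_of_card_le (hL k hk.le).1 (h1.trans (h3.trans (hL k hk.le).2.ge))
  have hbound : ∀ W : Finset (ℕ → ℕ), W ⊆ cappedBox c (n + 1) d →
      {w ∈ W | w n < i + (d + 1)} = W := fun W hW => filter_true_of_mem fun w hw => by
    have h1 := (mem_cappedBox.1 (hW hw)).2.2
    rw [sum_range_succ] at h1
    omega
  have hempty : ∀ W : Finset (ℕ → ℕ), W ⊆ cappedBox c (n + 1) d →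
      ∀ k w, w ∈ lastSlice n k W → k ≤ d := by
    intro W hW k w hw
    have h1 := (mem_cappedBox.1 (hW (mem_lastSlice.1 hw).2)).2.2
    rw [sum_range_succ] at h1
    simp at h1
    omega
  by_contra hlt
  rw [not_le, card_filter_lt, card_filter_lt] at hlt
  obtain ⟨k, hk, hklt⟩ := exists_lt_of_sum_lt hlt
  have htot : ∑ k ∈ range (i + (d + 1)), #(lastSlice n k V) ≤
      ∑ k ∈ range (i + (d + 1)), #(lastSlice n k U) := by
    rw [← card_filter_lt, ← card_filter_lt, hbound V hV.1, hbound U hU.1]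
    exact hcard
  rw [sum_range_add _ i, sum_range_add _ i] at htot
  obtain ⟨s, -, hslt⟩ := exists_lt_of_sum_lt (s := range (d + 1))
    (f := fun s => #(lastSlice n (i + s) V)) (g := fun s => #(lastSlice n (i + s) U)) (by linarith)
  have hkd : k ≤ d := by
    obtain ⟨x, hx⟩ := card_pos.1 (Nat.zero_lt_of_lt hklt)
    exact hempty V hV.1 k x hx
  have hsd : i + s ≤ d := by
    obtain ⟨x, hx⟩ := card_pos.1 (Nat.zero_lt_of_lt hslt)
    exact hempty U hU.1 _ x hx
  have hsc : i + s ≤ c n := by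
    obtain ⟨x, hx⟩ := card_pos.1 (Nat.zero_lt_of_lt hslt)
    obtain ⟨h1, h2⟩ := mem_lastSlice.1 hx
    exact (mem_cappedBox_of_update h1 ((hU' _ hsd).1 h2)).2
  obtain ⟨w, hw, hwL⟩ : ∃ w ∈ lastSlice n k V, w ∉ L k := not_subset.1 fun h => by
    have := card_le_card h
    rw [(hL k hkd).2] at this
    omega
  obtain ⟨z, hz, hzV⟩ : ∃ z ∈ L (i + s), z ∉ lastSlice n (i + s) V := not_subset.1 fun h => by
    have := card_le_card h
    rw [(hL _ hsd).2] at this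
    exact absurd hslt (not_lt.2 this)
  have hki : k < i := mem_range.1 hk
  obtain ⟨q, hq⟩ : ∃ q, i + s = k + q := ⟨i + s - k, by omega⟩
  have hzb := (hL _ hsd).1.1 hz
  have hzn := (mem_cappedBox.1 hzb).2.1 n le_rfl
  have hlt' : toLex (Function.update z n (i + s)) < toLex (Function.update w n k) := by
    by_contra hle
    refine hzV (mem_lastSlice.2 ⟨hzn, hV.2 _ (mem_lastSlice.1 hw).2 _ ?_ (not_lt.1 hle)⟩)
    have := update_mem_cappedBox hzb hsc
    rwa [Nat.sub_add_cancel hsd] at this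
  have hwb := lastSlice_subset_cappedBox (hV' k hkd).1 hw
  have hzw : toLex z < toLex w := by
    obtain ⟨j, hj, hjlt⟩ := toLex_lt_iff.1 hlt'
    rcases lt_trichotomy j n with h | h | h
    · refine toLex_lt_iff.2 ⟨j, fun t ht => ?_, ?_⟩
      · have : t ≠ n := by omega
        simpa [this] using hj t ht
      · simpa [h.ne] using hjlt
    · subst h
      simp at hjlt
      omega
    · have := hj n h
      simp at this
      omega
  rw [hq] at hz
  exact hwL (mem_of_iterated_shadow (fun k hk => (hL k hk).1) hsh (by omega) hz hwb hzw.le)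

lemma BoxStable.card_boxShadow_succ {c : ℕ → ℕ} {n d : ℕ} {U : Finset (ℕ → ℕ)}
    (hU : BoxStable c (n + 1) d U) : #(boxShadow c (n + 1) (d + 1) U) =
      #{u ∈ U | u n < c n} + #(boxShadow c n (d + 1) (lastSlice n 0 U)) := by
  rw [← card_filter_add_card_filter_not (fun w : ℕ → ℕ => w n ≠ 0)]
  congr 1
  · refine (card_nbij (fun u => u + Pi.single n 1) ?_ ?_ ?_).symm
    · intro u hu
      obtain ⟨hu, hlt⟩ := mem_filter.1 hu
      exact mem_filter.2 ⟨mem_boxShadow.2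
        ⟨add_single_mem_cappedBox (hU.1 hu) (by omega) hlt, u, hu, n, rfl⟩, by simp⟩
    · intro u _ v _ h
      exact add_right_cancel h
    · intro w hw
      obtain ⟨hw, hwn⟩ := mem_filter.1 (mem_coe.1 hw)
      obtain ⟨hwb, u, hu, i, hwu⟩ := mem_boxShadow.1 hw
      obtain ⟨v, hv, rfl⟩ := exists_eq_add_single hwb hwn
      refine ⟨v, mem_coe.2 (mem_filter.2 ⟨?_, ?_⟩), rfl⟩
      · by_cases hi : i = n
        · subst hi
          rwa [add_right_cancel hwu]
        · have := lt_of_ne_zero_of_mem_cappedBox hwb (i := i) (by rw [hwu]; simp)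
          exact hU.2 u hu v hv n i (by omega) hwu
      · simpa using (mem_cappedBox.1 hwb).1 n (by omega)
  · congr 1
    have hU' : BoxStable c (n + 1) (d + 0) U := hU
    ext w
    simp only [mem_filter, mem_boxShadow, not_not]
    constructor
    · rintro ⟨⟨hwb, u, hu, i, rfl⟩, hwn⟩
      have hin : i ≠ n := by
        rintro rfl
        simp at hwn
      have hun : u n = 0 := by simp [hin.symm] at hwn; exact hwn
      refine ⟨(mem_cappedBox_of_update (k := 0) hwn ?_).1, u, mem_lastSlice.2 ⟨hun, ?_⟩, i, rfl⟩
      · rwa [← hwn, Function.update_eq_self, hwn]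
      · rwa [← hun, Function.update_eq_self]
    · rintro ⟨hwb, u, hu, i, rfl⟩
      have hwn := (mem_cappedBox.1 hwb).2.1 n le_rfl
      obtain ⟨hun, hu⟩ := mem_lastSlice.1 hu
      have h := update_mem_cappedBox hwb (Nat.zero_le (c n))
      rw [← hwn, Function.update_eq_self, hwn] at h
      rw [← hun, Function.update_eq_self] at hu
      exact ⟨⟨h, u, hu, i, rfl⟩, hwn⟩

lemma shadowMono (c : ℕ → ℕ) (n : ℕ) : ShadowMono c n := by
  induction n with
  | zero =>
    intro d U V _ _ _
    have : boxShadow c 0 (d + 1) V = ∅ := eq_empty_of_forall_notMem fun w hw => by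
      have := (mem_cappedBox.1 (mem_boxShadow.1 hw).1).2.2
      simp at this
    simp [this]
  | succ n ih =>
    intro d U V hU hV hcard
    rw [hU.card_boxShadow_succ, hV.boxStable.card_boxShadow_succ]
    refine Nat.add_le_add (ih.card_filter_lt_le hU hV hcard _)
      (ih d _ _ (BoxStable.lastSlice_boxStable (k := 0) hU)
        (BoxLex.lastSlice_boxLex (k := 0) hV) ?_)
    have h := ih.card_filter_lt_le hU hV hcard 1
    rwa [card_filter_lt, card_filter_lt, sum_range_one, sum_range_one] at h

end BoxCombinatorics

section MonomialIdeals

variable {K : Type*} [Field K] {n r : ℕ}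

/-- Every monomial occurring in an element of `I` belongs to `I`. -/
def IsMonomialSupported (I : Ideal (MvPolynomial (Fin n) K)) : Prop :=
  ∀ f ∈ I, ∀ m ∈ f.support, (monomial m (1 : K) : MvPolynomial (Fin n) K) ∈ I

lemma mem_of_forall_monomial_mem {I : Ideal (MvPolynomial (Fin n) K)}
    {f : MvPolynomial (Fin n) K}
    (h : ∀ m ∈ f.support, (monomial m (1 : K) : MvPolynomial (Fin n) K) ∈ I) : f ∈ I := by
  rw [f.as_sum]
  refine sum_mem fun m hm => ?_
  have := I.mul_mem_left (C (f.coeff m)) (h m hm)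
  rwa [C_mul_monomial, mul_one] at this

lemma isMonomialSupported_span (M : Set (Fin n →₀ ℕ)) :
    IsMonomialSupported
      (Ideal.span ((fun m => (monomial m (1 : K) : MvPolynomial (Fin n) K)) '' M)) := by
  classical
  intro f hf m hm
  rw [mem_ideal_span_monomial_image] at hf ⊢
  intro m' hm'
  rw [support_monomial, if_neg one_ne_zero, Finset.mem_singleton] at hm'
  exact hm' ▸ hf m hm

lemma monomial_mem_span_iff {M : Set (Fin n →₀ ℕ)} {m : Fin n →₀ ℕ} :
    (monomial m (1 : K) : MvPolynomial (Fin n) K) ∈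
      Ideal.span ((fun m => (monomial m (1 : K) : MvPolynomial (Fin n) K)) '' M) ↔
      ∃ s ∈ M, s ≤ m := by
  classical
  rw [mem_ideal_span_monomial_image, support_monomial, if_neg one_ne_zero]
  simp

lemma IsMonomialSupported.mem_support_sup {I J : Ideal (MvPolynomial (Fin n) K)}
    (hI : IsMonomialSupported I) (hJ : IsMonomialSupported J) {f : MvPolynomial (Fin n) K}
    (hf : f ∈ I ⊔ J) {m : Fin n →₀ ℕ} (hm : m ∈ f.support) :
    (monomial m (1 : K) : MvPolynomial (Fin n) K) ∈ I ∨
      (monomial m (1 : K) : MvPolynomial (Fin n) K) ∈ J := by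
  classical
  obtain ⟨g, hg, h, hh, rfl⟩ := Submodule.mem_sup.1 hf
  rcases Finset.mem_union.1 (support_add hm) with h1 | h1
  · exact Or.inl (hI g hg m h1)
  · exact Or.inr (hJ h hh m h1)

lemma IsMonomialSupported.sup {I J : Ideal (MvPolynomial (Fin n) K)}
    (hI : IsMonomialSupported I) (hJ : IsMonomialSupported J) :
    IsMonomialSupported (I ⊔ J) := fun _ hf _ hm =>
  (hI.mem_support_sup hJ hf hm).elim (fun h => Ideal.mem_sup_left h) fun h => Ideal.mem_sup_right h

lemma IsMonomialSupported.monomial_mem_sup {I J : Ideal (MvPolynomial (Fin n) K)}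
    (hI : IsMonomialSupported I) (hJ : IsMonomialSupported J) {m : Fin n →₀ ℕ} :
    (monomial m (1 : K) : MvPolynomial (Fin n) K) ∈ I ⊔ J ↔
      (monomial m (1 : K) : MvPolynomial (Fin n) K) ∈ I ∨
        (monomial m (1 : K) : MvPolynomial (Fin n) K) ∈ J := by
  refine ⟨fun h => hI.mem_support_sup hJ h ?_, fun h => h.elim (fun h => Ideal.mem_sup_left h)
    fun h => Ideal.mem_sup_right h⟩
  simp [mem_support_iff]

lemma purePowers_eq_span (hrn : r ≤ n) (a : Fin r → ℕ) :
    purePowers K hrn a = Ideal.span ((fun m => (monomial m (1 : K) : MvPolynomial (Fin n) K)) ''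
      Set.range fun i : Fin r => Finsupp.single (Fin.castLE hrn i) (a i)) := by
  rw [purePowers, ← Set.range_comp]
  congr 2
  funext i
  simp [X_pow_eq_monomial]

lemma monomial_mem_purePowers {hrn : r ≤ n} {a : Fin r → ℕ} {m : Fin n →₀ ℕ} :
    (monomial m (1 : K) : MvPolynomial (Fin n) K) ∈ purePowers K hrn a ↔
      ∃ i : Fin r, a i ≤ m (Fin.castLE hrn i) := by
  rw [purePowers_eq_span, monomial_mem_span_iff]
  simp

lemma span_X_pow_eq_span (i : Fin n) (k : ℕ) :
    (Ideal.span {X i ^ k} : Ideal (MvPolynomial (Fin n) K)) =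
      Ideal.span ((fun m => (monomial m (1 : K) : MvPolynomial (Fin n) K)) ''
        {Finsupp.single i k}) := by
  simp [X_pow_eq_monomial]

lemma monomial_mem_span_X_pow {i : Fin n} {k : ℕ} {m : Fin n →₀ ℕ} :
    (monomial m (1 : K) : MvPolynomial (Fin n) K) ∈ Ideal.span {X i ^ k} ↔ k ≤ m i := by
  rw [span_X_pow_eq_span, monomial_mem_span_iff]
  simp

lemma expDeg_eq_degree (m : Fin n →₀ ℕ) : expDeg m = m.degree :=
  (Finsupp.degree_eq_sum m).symm

lemma expDeg_finite (n d : ℕ) : {m : Fin n →₀ ℕ | expDeg m = d}.Finite := by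
  refine (Set.finite_Iic (Finsupp.equivFunOnFinite.symm fun _ : Fin n => d)).subset ?_
  rintro m rfl i
  exact Finset.single_le_sum (f := fun j => m j) (fun _ _ => Nat.zero_le _) (Finset.mem_univ i)

lemma component_eq_restrictSupport {I : Ideal (MvPolynomial (Fin n) K)}
    (hI : IsMonomialSupported I) (d : ℕ) :
    component I d = restrictSupport K
      {m | expDeg m = d ∧ (monomial m (1 : K) : MvPolynomial (Fin n) K) ∈ I} := by
  ext f
  rw [component, Submodule.mem_inf, Submodule.restrictScalars_mem,
    homogeneousSubmodule_eq_finsupp_supported, mem_restrictSupport_iff]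
  constructor
  · rintro ⟨h1, h2⟩ m hm
    exact ⟨(expDeg_eq_degree m).trans (h2 hm), hI f h1 m hm⟩
  · intro h
    exact ⟨mem_of_forall_monomial_mem fun m hm => (h hm).2,
      fun m hm => (expDeg_eq_degree m).symm.trans (h hm).1⟩

lemma hilb_eq_ncard {I : Ideal (MvPolynomial (Fin n) K)} (hI : IsMonomialSupported I) (d : ℕ) :
    hilb I d =
      {m | expDeg m = d ∧ (monomial m (1 : K) : MvPolynomial (Fin n) K) ∈ I}.ncard := by
  rw [hilb, component_eq_restrictSupport hI,
    Module.finrank_eq_nat_card_basis (basisRestrictSupport K _), Nat.card_coe_set_eq]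

lemma restrictSupport_union (s t : Set (Fin n →₀ ℕ)) :
    restrictSupport K (s ∪ t) = restrictSupport K s ⊔ restrictSupport K t := by
  simp only [restrictSupport_eq_span, Set.image_union, Submodule.span_union]

lemma isMonomialSupported_purePowers (hrn : r ≤ n) (a : Fin r → ℕ) :
    IsMonomialSupported (purePowers K hrn a) :=
  purePowers_eq_span (K := K) hrn a ▸ isMonomialSupported_span _

lemma IsLPP.component_eq {hrn : r ≤ n} {a : Fin r → ℕ} {J : Ideal (MvPolynomial (Fin n) K)}
    (hJ : IsLPP hrn a J) (d : ℕ) : ∃ S : Set (Fin n →₀ ℕ), IsLexSegment n d S ∧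
      component J d = restrictSupport K (S ∪ {m | expDeg m = d ∧
        (monomial m (1 : K) : MvPolynomial (Fin n) K) ∈ purePowers K hrn a}) := by
  obtain ⟨S, hS, h⟩ := hJ.2 d
  refine ⟨S, hS, ?_⟩
  rw [h, restrictSupport_union, restrictSupport_eq_span,
    component_eq_restrictSupport (isMonomialSupported_purePowers hrn a)]

lemma monomial_mem_component_iff {I : Ideal (MvPolynomial (Fin n) K)} {m : Fin n →₀ ℕ} :
    (monomial m (1 : K) : MvPolynomial (Fin n) K) ∈ component I (expDeg m) ↔
      (monomial m (1 : K) : MvPolynomial (Fin n) K) ∈ I := by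
  rw [component, Submodule.mem_inf, Submodule.restrictScalars_mem, mem_homogeneousSubmodule]
  exact and_iff_left (isHomogeneous_monomial 1 (expDeg_eq_degree m).symm)

lemma IsLPP.monomial_mem_iff {hrn : r ≤ n} {a : Fin r → ℕ} {J : Ideal (MvPolynomial (Fin n) K)}
    (hJ : IsLPP hrn a J) (d : ℕ) : ∃ S : Set (Fin n →₀ ℕ), IsLexSegment n d S ∧
      ∀ m, expDeg m = d → ((monomial m (1 : K) : MvPolynomial (Fin n) K) ∈ J ↔
        m ∈ S ∨ (monomial m (1 : K) : MvPolynomial (Fin n) K) ∈ purePowers K hrn a) := by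
  obtain ⟨S, hS, h⟩ := hJ.component_eq d
  refine ⟨S, hS, ?_⟩
  rintro m rfl
  rw [← monomial_mem_component_iff, h, monomial_mem_restrictSupport]
  simp

lemma IsLPP.isMonomialSupported {hrn : r ≤ n} {a : Fin r → ℕ}
    {J : Ideal (MvPolynomial (Fin n) K)} (hJ : IsLPP hrn a J) : IsMonomialSupported J := by
  intro f hf m hm
  obtain ⟨S, -, h⟩ := hJ.component_eq (expDeg m)
  have hmem : homogeneousComponent (expDeg m) f ∈ component J (expDeg m) :=
    ⟨hJ.1 f hf _, homogeneousComponent_mem _ _⟩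
  rw [← monomial_mem_component_iff, h, monomial_mem_restrictSupport]
  rw [h, mem_restrictSupport_iff] at hmem
  refine Or.inl (hmem ?_)
  rw [Finset.mem_coe, mem_support_iff, coeff_homogeneousComponent,
    if_pos (expDeg_eq_degree m).symm]
  exact mem_support_iff.1 hm

lemma IsLPP.purePowers_le {hrn : r ≤ n} {a : Fin r → ℕ} {J : Ideal (MvPolynomial (Fin n) K)}
    (hJ : IsLPP hrn a J) : purePowers K hrn a ≤ J := by
  intro f hf
  refine mem_of_forall_monomial_mem fun m hm => ?_
  obtain ⟨S, -, h⟩ := hJ.monomial_mem_iff (expDeg m)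
  exact (h m rfl).2 (Or.inr (isMonomialSupported_purePowers hrn a f hf m hm))

/-- Extension of an exponent vector by zero. -/
def extendExp (m : Fin n →₀ ℕ) (i : ℕ) : ℕ := if h : i < n then m ⟨i, h⟩ else 0

lemma extendExp_val (m : Fin n →₀ ℕ) (i : Fin n) : extendExp m i = m i := by
  simp [extendExp]

lemma extendExp_of_le (m : Fin n →₀ ℕ) {i : ℕ} (h : n ≤ i) : extendExp m i = 0 :=
  dif_neg (not_lt.2 h)

lemma extendExp_injective : Function.Injective (extendExp (n := n)) := by
  intro m m' h
  ext i
  rw [← extendExp_val, h, extendExp_val]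

lemma sum_extendExp (m : Fin n →₀ ℕ) : ∑ i ∈ Finset.range n, extendExp m i = expDeg m := by
  rw [Finset.sum_range]
  simp [extendExp_val, expDeg]

lemma exists_extendExp_eq {c v : ℕ → ℕ} {d : ℕ} (hv : v ∈ cappedBox c n d) :
    ∃ m : Fin n →₀ ℕ, extendExp m = v := by
  refine ⟨Finsupp.equivFunOnFinite.symm fun i => v i, ?_⟩
  funext i
  by_cases hi : i < n
  · simp [extendExp, hi]
  · rw [extendExp_of_le _ (not_lt.1 hi), (mem_cappedBox.1 hv).2.1 i (not_lt.1 hi)]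

lemma lexLe_of_toLex_extendExp_le {m m' : Fin n →₀ ℕ}
    (h : toLex (extendExp m) ≤ toLex (extendExp m')) : lexLe m m' := by
  rcases h.eq_or_lt with h | h
  · exact Or.inl (extendExp_injective (toLex.injective h))
  · obtain ⟨j, hj, hjlt⟩ := toLex_lt_iff.1 h
    have hjn : j < n := by
      by_contra hjn
      rw [extendExp_of_le m' (not_lt.1 hjn)] at hjlt
      omega
    refine Or.inr ⟨⟨j, hjn⟩, fun t ht => ?_, ?_⟩
    · have := hj t ht
      rwa [extendExp_val, extendExp_val] at this
    · rw [← extendExp_val, ← extendExp_val]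
      exact hjlt

/-- The bounds cutting out, in degree `d`, the monomials outside the pure-powers ideal. -/
def powerBound (a : Fin r → ℕ) (d i : ℕ) : ℕ := if h : i < r then a ⟨i, h⟩ - 1 else d

lemma extendExp_mem_cappedBox {hrn : r ≤ n} {a : Fin r → ℕ} (hpos : ∀ i, 0 < a i)
    {m : Fin n →₀ ℕ} {d : ℕ} : extendExp m ∈ cappedBox (powerBound a d) n d ↔
      expDeg m = d ∧ (monomial m (1 : K) : MvPolynomial (Fin n) K) ∉ purePowers K hrn a := by
  rw [mem_cappedBox, sum_extendExp, monomial_mem_purePowers]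
  push Not
  constructor
  · rintro ⟨h1, -, h2⟩
    refine ⟨h2, fun i => ?_⟩
    have h := h1 i (by omega)
    rw [powerBound, dif_pos i.2] at h
    exact (extendExp_val m (Fin.castLE hrn i)).symm.trans_lt (Nat.lt_of_le_sub_one (hpos i) h)
  · rintro ⟨h2, h1⟩
    refine ⟨fun i hi => ?_, fun i hi => extendExp_of_le m hi, h2⟩
    rw [powerBound]
    split_ifs with h
    · exact Nat.le_sub_one_of_lt ((extendExp_val m ⟨i, hi⟩).trans_lt (h1 ⟨i, h⟩))
    · rw [← h2, ← sum_extendExp]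
      exact Finset.single_le_sum (f := extendExp m) (fun _ _ => Nat.zero_le _)
        (Finset.mem_range.2 hi)

open scoped Classical in
/-- The degree-`d` monomials of `I` outside the pure-powers ideal. -/
noncomputable def boxPart (a : Fin r → ℕ) (I : Ideal (MvPolynomial (Fin n) K)) (d : ℕ) :
    Finset (ℕ → ℕ) :=
  {u ∈ cappedBox (powerBound a d) n d | ∃ m : Fin n →₀ ℕ, extendExp m = u ∧
    (monomial m (1 : K) : MvPolynomial (Fin n) K) ∈ I}

lemma extendExp_mem_boxPart {a : Fin r → ℕ} {I : Ideal (MvPolynomial (Fin n) K)} {d : ℕ}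
    {m : Fin n →₀ ℕ} : extendExp m ∈ boxPart a I d ↔
      extendExp m ∈ cappedBox (powerBound a d) n d ∧
        (monomial m (1 : K) : MvPolynomial (Fin n) K) ∈ I := by
  classical
  rw [boxPart, Finset.mem_filter]
  refine and_congr_right fun _ => ⟨?_, fun h => ⟨m, rfl, h⟩⟩
  rintro ⟨m', h, h'⟩
  rwa [← extendExp_injective h]

lemma boxPart_subset {a : Fin r → ℕ} {I : Ideal (MvPolynomial (Fin n) K)} {d : ℕ} :
    boxPart a I d ⊆ cappedBox (powerBound a d) n d := by
  classical
  exact Finset.filter_subset _ _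

lemma IsLPP.boxLex_boxPart {hrn : r ≤ n} {a : Fin r → ℕ} (hpos : ∀ i, 0 < a i)
    {J : Ideal (MvPolynomial (Fin n) K)} (hJ : IsLPP hrn a J) (d : ℕ) :
    BoxLex (powerBound a d) n d (boxPart a J d) := by
  refine ⟨boxPart_subset, fun u hu v hv h => ?_⟩
  obtain ⟨m, rfl⟩ := exists_extendExp_eq (boxPart_subset hu)
  obtain ⟨m', rfl⟩ := exists_extendExp_eq hv
  obtain ⟨hm, hmJ⟩ := extendExp_mem_boxPart.1 hu
  obtain ⟨hd, hP⟩ := (extendExp_mem_cappedBox (K := K) (hrn := hrn) hpos).1 hm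
  obtain ⟨hd', -⟩ := (extendExp_mem_cappedBox (K := K) (hrn := hrn) hpos).1 hv
  obtain ⟨S, hS, hSJ⟩ := hJ.monomial_mem_iff d
  refine extendExp_mem_boxPart.2 ⟨hv, (hSJ m' hd').2 (Or.inl ?_)⟩
  exact hS.2 m (((hSJ m hd).1 hmJ).resolve_right hP) m' hd' (lexLe_of_toLex_extendExp_le h)

lemma IsStronglyStable.isMonomialSupported {S : Ideal (MvPolynomial (Fin n) K)}
    (hS : IsStronglyStable S) : IsMonomialSupported S := by
  obtain ⟨M, rfl⟩ := hS.1
  exact isMonomialSupported_span M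

lemma IsStronglyStable.boxStable_boxPart {hrn : r ≤ n} {a : Fin r → ℕ} (hpos : ∀ i, 0 < a i)
    {S : Ideal (MvPolynomial (Fin n) K)} (hS : IsStronglyStable S) (d : ℕ) :
    BoxStable (powerBound a d) n d (boxPart a (S ⊔ purePowers K hrn a) d) := by
  refine ⟨boxPart_subset, fun u hu v hv i j hji h => ?_⟩
  obtain ⟨m, rfl⟩ := exists_extendExp_eq (boxPart_subset hu)
  obtain ⟨m', rfl⟩ := exists_extendExp_eq hv
  obtain ⟨hm, hmI⟩ := extendExp_mem_boxPart.1 hu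
  obtain ⟨-, hP⟩ := (extendExp_mem_cappedBox (K := K) (hrn := hrn) hpos).1 hm
  rw [hS.isMonomialSupported.monomial_mem_sup (isMonomialSupported_purePowers hrn a)] at hmI
  have hmS := hmI.resolve_right hP
  have hne : i ≠ j := by omega
  have hi : i < n := by
    by_contra hi
    have := congrFun h i
    simp [extendExp_of_le m (not_lt.1 hi), hne] at this
  obtain ⟨p, rfl⟩ : ∃ p, m = p + Finsupp.single (⟨i, hi⟩ : Fin n) 1 := by
    refine ⟨m - Finsupp.single ⟨i, hi⟩ 1, (tsub_add_cancel_of_le ?_).symm⟩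
    have := congrFun h i
    simp only [Pi.add_apply, Pi.single_eq_same, Pi.single_eq_of_ne hne] at this
    rw [Finsupp.single_le_iff, ← extendExp_val]
    simp only
    omega
  obtain rfl : m' = p + Finsupp.single (⟨j, hji.trans hi⟩ : Fin n) 1 := by
    ext t
    have := congrFun h t
    rw [Pi.add_apply, Pi.add_apply, extendExp_val, extendExp_val, Finsupp.add_apply] at this
    simp only [Finsupp.add_apply, Finsupp.single_apply, Pi.single_apply, Fin.ext_iff] at this ⊢
    grind
  exact extendExp_mem_boxPart.2 ⟨hv, Ideal.mem_sup_left (hS.2 p _ _ hji.le hmS)⟩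

open scoped Classical in
lemma ncard_eq_add_card_boxPart {hrn : r ≤ n} {a : Fin r → ℕ} (hpos : ∀ i, 0 < a i)
    {I : Ideal (MvPolynomial (Fin n) K)} (hPI : purePowers K hrn a ≤ I) (d : ℕ)
    (p : (ℕ → ℕ) → Prop) :
    {m : Fin n →₀ ℕ | expDeg m = d ∧
      ((monomial m (1 : K) : MvPolynomial (Fin n) K) ∈ I ∨ p (extendExp m))}.ncard =
    {m : Fin n →₀ ℕ | expDeg m = d ∧
      ((monomial m (1 : K) : MvPolynomial (Fin n) K) ∈ purePowers K hrn a ∨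
        p (extendExp m))}.ncard + (Finset.filter (fun u => ¬ p u) (boxPart a I d)).card := by
  have hcard : (Finset.filter (fun u => ¬ p u) (boxPart a I d)).card =
      (extendExp ⁻¹' (Finset.filter (fun u => ¬ p u) (boxPart a I d) : Set (ℕ → ℕ)) :
        Set (Fin n →₀ ℕ)).ncard := by
    rw [← Set.ncard_coe_finset, Set.ncard_preimage_of_injective_subset_range extendExp_injective]
    intro u hu
    exact exists_extendExp_eq (boxPart_subset (Finset.mem_filter.1 (Finset.mem_coe.1 hu)).1)
  have hmem : ∀ m : Fin n →₀ ℕ,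
      m ∈ extendExp ⁻¹' (Finset.filter (fun u => ¬ p u) (boxPart a I d) : Set (ℕ → ℕ)) ↔
      ((expDeg m = d ∧ (monomial m (1 : K) : MvPolynomial (Fin n) K) ∉ purePowers K hrn a) ∧
        (monomial m (1 : K) : MvPolynomial (Fin n) K) ∈ I) ∧ ¬ p (extendExp m) := fun m => by
    rw [Set.mem_preimage, Finset.mem_coe, Finset.mem_filter, extendExp_mem_boxPart,
      extendExp_mem_cappedBox (K := K) (hrn := hrn) hpos]
  rw [hcard, ← Set.ncard_union_eq ?_ ((expDeg_finite n d).subset fun m hm => hm.1)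
    ((expDeg_finite n d).subset fun m hm => ((hmem m).1 hm).1.1.1)]
  · congr 1
    ext m
    have hP := @hPI (monomial m (1 : K))
    rw [Set.mem_union, hmem]
    simp only [Set.mem_ofPred_eq]
    tauto
  · rw [Set.disjoint_left]
    intro m h1 h2
    rw [hmem] at h2
    simp only [Set.mem_ofPred_eq] at h1
    tauto

end MonomialIdeals

/-- **Strong hyperplane restriction (Gasharov).** If `I` is an `a`-spp ideal and `J` is the
`a`-lpp ideal with the same Hilbert function, then for every `i > 0` and every degree `d`,
`dim_K (I + (x_n^i))_d ≥ dim_K (J + (x_n^i))_d`. -/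
theorem gasharov_strong_hyperplane_restriction {K : Type*} [Field K] {n r : ℕ}
    (hn : 0 < n) (hrn : r ≤ n)
    (a : Fin r → ℕ) (hpos : ∀ i, 0 < a i) (hmono : Monotone a)
    (I : Ideal (MvPolynomial (Fin n) K)) (hI : IsSPP hrn a I)
    (J : Ideal (MvPolynomial (Fin n) K)) (hJ : IsLPP hrn a J)
    (hHF : ∀ d : ℕ, hilb J d = hilb I d) :
    ∀ i : ℕ, 0 < i → ∀ d : ℕ,
      hilb (J ⊔ Ideal.span {X (⟨n - 1, by omega⟩ : Fin n) ^ i}) d ≤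
        hilb (I ⊔ Ideal.span {X (⟨n - 1, by omega⟩ : Fin n) ^ i}) d := by
  obtain ⟨S, hS, rfl⟩ := hI
  obtain ⟨N, rfl⟩ := Nat.exists_eq_succ_of_ne_zero hn.ne'
  classical
  have hSP := hS.isMonomialSupported.sup (isMonomialSupported_purePowers (K := K) hrn a)
  intro i _ d
  have hilb_eq : ∀ I : Ideal (MvPolynomial (Fin (N + 1)) K), IsMonomialSupported I →
      purePowers K hrn a ≤ I → hilb I d = hilb (purePowers K hrn a) d +
        (boxPart a I d).card := fun I hI hP => by
    have := ncard_eq_add_card_boxPart hpos hP d fun _ => False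
    simp only [or_false, not_false_eq_true, Finset.filter_true] at this
    rw [hilb_eq_ncard hI, hilb_eq_ncard (isMonomialSupported_purePowers hrn a), this]
  have hilb_sup_eq : ∀ I : Ideal (MvPolynomial (Fin (N + 1)) K), IsMonomialSupported I →
      purePowers K hrn a ≤ I → hilb (I ⊔ Ideal.span {X (⟨N, by omega⟩ : Fin (N + 1)) ^ i}) d =
        {m : Fin (N + 1) →₀ ℕ | expDeg m = d ∧
          ((monomial m (1 : K) : MvPolynomial (Fin (N + 1)) K) ∈ purePowers K hrn a ∨
            i ≤ extendExp m N)}.ncard +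
          (Finset.filter (fun u => u N < i) (boxPart a I d)).card := fun I hI hP => by
    have hX : IsMonomialSupported (Ideal.span {X (⟨N, by omega⟩ : Fin (N + 1)) ^ i} :
        Ideal (MvPolynomial (Fin (N + 1)) K)) :=
      span_X_pow_eq_span (K := K) _ i ▸ isMonomialSupported_span _
    have := ncard_eq_add_card_boxPart hpos hP d fun u => i ≤ u N
    simp only [not_le] at this
    rw [hilb_eq_ncard (hI.sup hX), ← this]
    congr 1
    ext m
    simp only [Set.mem_ofPred_eq, hI.monomial_mem_sup hX, monomial_mem_span_X_pow,
      ← extendExp_val]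
  have hcard := hHF d
  rw [hilb_eq J hJ.isMonomialSupported hJ.purePowers_le, hilb_eq _ hSP le_sup_right] at hcard
  refine (hilb_sup_eq J hJ.isMonomialSupported hJ.purePowers_le).trans_le
    (le_of_le_of_eq ?_ (hilb_sup_eq _ hSP le_sup_right).symm)
  have h := (shadowMono (powerBound a d) N).card_filter_lt_le
    (hS.boxStable_boxPart (hrn := hrn) hpos d) (hJ.boxLex_boxPart hpos d) (by omega) i
  convert Nat.add_le_add_left h _
end
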